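/- Let u, p be a smooth solution of the steady Navier–Stokes system -Δu + u·∇u = -∇p, div u = 0 in ℝ³. For q > 3 and 1 ≤ ℓ ≤ ∞ there is a constant C such that for all R > 0, ∫_{B(R/2)} |∇u|² dx ≤ C R^{-2} ∫_{B(R)\B(R/2)} |u|² dx + C R^{2 - 9/q} ‖u‖³_{L^{q,ℓ}(B(R)\B(R/2))}. -/

import Mathlib

open MeasureTheory Metric Filter ENNReal

noncomputable section

abbrev E3 := EuclideanSpace ℝ (Fin 3)

/-- Lorentz quasinorm on a set `Ω` (with `ℓ = ∞` giving the weak norm). -/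
noncomputable def lorentzNorm {α F : Type*} [MeasurableSpace α] [NormedAddCommGroup F]
    (μ : Measure α) (p ℓ : ℝ≥0∞) (f : α → F) (Ω : Set α) : ℝ≥0∞ :=
  if ℓ = ⊤ then
    ⨆ σ : NNReal, (σ : ℝ≥0∞) * (μ {x | x ∈ Ω ∧ (σ : ℝ) < ‖f x‖}) ^ (1 / p).toReal
  else
    (∫⁻ σ in Set.Ioi (0 : ℝ),
        ENNReal.ofReal (σ ^ (ℓ.toReal - 1)) *
          (μ {x | x ∈ Ω ∧ σ < ‖f x‖}) ^ (ℓ / p).toReal) ^ (1 / ℓ).toReal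

/-- The annulus `B(R) \ B(R/2)` centered at the origin in `ℝ³`. -/
def ann (R : ℝ) : Set E3 := Metric.ball (0 : E3) R \ Metric.ball (0 : E3) (R / 2)

/-- Divergence of a vector field on `ℝ³`. -/
noncomputable def divg (u : E3 → E3) (x : E3) : ℝ :=
  ∑ i, fderiv ℝ u x (EuclideanSpace.single i 1) i

/-- Componentwise Laplacian of a vector field on `ℝ³`. -/
noncomputable def lap (u : E3 → E3) (x : E3) : E3 :=
  ∑ i, fderiv ℝ (fun y => fderiv ℝ u y (EuclideanSpace.single i 1)) x (EuclideanSpace.single i 1)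

/-- Convective term `(u · ∇) u`. -/
noncomputable def conv (u : E3 → E3) (x : E3) : E3 := fderiv ℝ u x (u x)

/-- Gradient of a scalar function on `ℝ³`. -/
noncomputable def gradp (p : E3 → ℝ) (x : E3) : E3 :=
  ∑ i, fderiv ℝ p x (EuclideanSpace.single i 1) • EuclideanSpace.single i 1

/-- The steady Navier–Stokes system `-Δu + (u·∇)u + ∇p = 0`, `div u = 0`. -/
def SteadyNS (u : E3 → E3) (p : E3 → ℝ) : Prop :=
  (∀ x, -lap u x + conv u x + gradp p x = 0) ∧ (∀ x, divg u x = 0)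

namespace Caccioppoli

/-- Smooth scalar functions on `ℝ³`. -/
abbrev Smooth (f : E3 → ℝ) : Prop := ContDiff ℝ ((⊤ : ℕ∞) : WithTop ℕ∞) f

/-- Smooth compactly supported scalar functions on `ℝ³`. -/
structure IsTest (f : E3 → ℝ) : Prop where
  smooth : Smooth f
  compact : HasCompactSupport f

/-- The `i`-th coordinate vector. -/
abbrev bv (i : Fin 3) : E3 := EuclideanSpace.single i 1

/-- The `i`-th partial derivative. -/
def pd (i : Fin 3) (f : E3 → ℝ) (x : E3) : ℝ := fderiv ℝ f x (bv i)

/-- The scalar Laplacian. -/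
def lapl (f : E3 → ℝ) (x : E3) : ℝ := ∑ i, pd i (pd i f) x

variable {f g : E3 → ℝ} {i j : Fin 3}

protected theorem Smooth.diff (hf : Smooth f) : Differentiable ℝ f := hf.differentiable (by simp)

protected theorem Smooth.pd (hf : Smooth f) (i : Fin 3) : Smooth (pd i f) :=
  (hf.fderiv_right (m := ((⊤ : ℕ∞) : WithTop ℕ∞)) (by norm_cast)).clm_apply contDiff_const

protected theorem Smooth.lapl (hf : Smooth f) : Smooth (lapl f) :=
  ContDiff.sum fun i _ => (hf.pd i).pd i

protected theorem IsTest.pd (hf : IsTest f) (i : Fin 3) : IsTest (pd i f) :=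
  ⟨hf.smooth.pd i, by
    refine (hf.compact.fderiv (𝕜 := ℝ)).mono' ?_
    intro x hx
    refine subset_tsupport _ ?_
    intro h
    apply hx
    simp [Caccioppoli.pd, h]⟩

protected theorem IsTest.add (hf : IsTest f) (hg : IsTest g) : IsTest (fun x => f x + g x) :=
  ⟨hf.smooth.add hg.smooth, hf.compact.add hg.compact⟩

protected theorem Smooth.mul_test (hf : Smooth f) (hg : IsTest g) : IsTest (fun x => f x * g x) :=
  ⟨hf.mul hg.smooth, hg.compact.mul_left⟩

protected theorem IsTest.mul_smooth (hf : IsTest f) (hg : Smooth g) : IsTest (fun x => f x * g x) :=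
  ⟨hf.smooth.mul hg, hf.compact.mul_right⟩

protected theorem IsTest.const_mul (c : ℝ) (hf : IsTest f) : IsTest (fun x => c * f x) :=
  Smooth.mul_test (f := fun _ => c) contDiff_const hf

protected theorem IsTest.sum {ι : Type*} (s : Finset ι) {F : ι → E3 → ℝ} (h : ∀ i ∈ s, IsTest (F i)) :
    IsTest (fun x => ∑ i ∈ s, F i x) := by
  classical
  induction s using Finset.induction_on with
  | empty => exact ⟨by simpa using contDiff_const, by simpa using! (HasCompactSupport.zero : HasCompactSupport (0 : E3 → ℝ))⟩
  | insert a s ha ih =>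
    simp only [Finset.sum_insert ha]
    exact (h a (by simp)).add (ih fun i hi => h i (by simp [hi]))

protected theorem IsTest.lapl (hf : IsTest f) : IsTest (lapl f) :=
  IsTest.sum _ fun i _ => (hf.pd i).pd i

protected theorem IsTest.continuous (hf : IsTest f) : Continuous f := hf.smooth.continuous

protected theorem IsTest.integrable (hf : IsTest f) : Integrable f :=
  hf.continuous.integrable_of_hasCompactSupport hf.compact

protected theorem IsTest.comp_homeo (hf : IsTest f) (e : E3 ≃ₜ E3)
    (he : ContDiff ℝ ((⊤ : ℕ∞) : WithTop ℕ∞) e) : IsTest (fun x => f (e x)) :=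
  ⟨hf.smooth.comp he, hf.compact.comp_homeomorph e⟩

protected theorem IsTest.comp_sub_left (hf : IsTest f) (a : E3) : IsTest (fun x => f (a - x)) :=
  hf.comp_homeo (Homeomorph.subLeft a) (contDiff_const.sub contDiff_id)

protected theorem IsTest.comp_sub_right (hf : IsTest f) (a : E3) : IsTest (fun x => f (x - a)) :=
  hf.comp_homeo (Homeomorph.subRight a) (contDiff_id.sub contDiff_const)

protected theorem IsTest.bounded (hf : IsTest f) : ∃ C, 0 ≤ C ∧ ∀ x, |f x| ≤ C := by
  obtain ⟨C, hC⟩ := hf.continuous.bounded_above_of_compact_support hf.compact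
  exact ⟨C, (norm_nonneg _).trans (hC 0), hC⟩

theorem pd_add (hf : Smooth f) (hg : Smooth g) (x : E3) :
    pd i (fun y => f y + g y) x = pd i f x + pd i g x := by
  simp only [pd]
  rw [fderiv_fun_add (hf.diff x) (hg.diff x)]
  rfl

theorem pd_mul (hf : Smooth f) (hg : Smooth g) (x : E3) :
    pd i (fun y => f y * g y) x = f x * pd i g x + pd i f x * g x := by
  simp only [pd]
  rw [fderiv_fun_mul (hf.diff x) (hg.diff x)]
  simp [mul_comm]

theorem pd_const_mul (c : ℝ) (hf : Smooth f) (x : E3) :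
    pd i (fun y => c * f y) x = c * pd i f x := by
  simp only [pd]
  rw [fderiv_const_mul (hf.diff x)]
  rfl

theorem pd_sum {ι : Type*} (s : Finset ι) {F : ι → E3 → ℝ} (h : ∀ k ∈ s, Smooth (F k)) (x : E3) :
    pd i (fun y => ∑ k ∈ s, F k y) x = ∑ k ∈ s, pd i (F k) x := by
  simp only [pd]
  rw [fderiv_fun_sum (fun k hk => (h k hk).diff x)]
  simp

theorem pd_sub_right (f : E3 → ℝ) (a x : E3) :
    pd i (fun y => f (y - a)) x = pd i f (x - a) := by
  simp only [pd]
  rw [fderiv_comp_sub]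

theorem pd_scale (hf : Smooth f) (a x : E3) (s : ℝ) :
    pd i (fun y => f (a + s • y)) x = s * pd i f (a + s • x) := by
  have h : HasFDerivAt (fun y : E3 => a + s • y) (s • ContinuousLinearMap.id ℝ E3) x :=
    ((hasFDerivAt_id x).const_smul s).const_add a
  have := ((hf.diff (a + s • x)).hasFDerivAt.comp x h).fderiv
  simp only [pd]
  rw [show (fun y => f (a + s • y)) = f ∘ fun y => a + s • y from rfl, this]
  simp

theorem pd_sub_left (hf : Smooth f) (a x : E3) :
    pd i (fun y => f (a - y)) x = - pd i f (a - x) := by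
  simpa [sub_eq_add_neg] using pd_scale (i := i) hf a x (-1)

theorem pd_comm (hf : Smooth f) (x : E3) : pd i (pd j f) x = pd j (pd i f) x := by
  have h2 : DifferentiableAt ℝ (fderiv ℝ f) x :=
    (hf.fderiv_right (m := 1) (by norm_cast)).differentiable (by simp) x
  have key : ∀ a b : Fin 3, pd a (pd b f) x = fderiv ℝ (fderiv ℝ f) x (bv a) (bv b) := by
    intro a b
    change fderiv ℝ (fun y => fderiv ℝ f y (bv b)) x (bv a) = _
    rw [fderiv_clm_apply h2 (differentiableAt_const _)]
    simp
  rw [key, key]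
  have := (hf.contDiffAt (x := x)).isSymmSndFDerivAt (by simp; exact WithTop.coe_le_coe.2 le_top)
  exact this _ _

theorem fderiv_eq_sum_pd (f : E3 → ℝ) (x z : E3) : fderiv ℝ f x z = ∑ i, z i * pd i f x := by
  have hz : z = ∑ i, z i • bv i := by
    ext k
    simp [Pi.single_apply]
  conv_lhs => rw [hz]
  simp [pd]

theorem integral_mul_pd (hf'g : Integrable fun x => pd i f x * g x)
    (hfg' : Integrable fun x => f x * pd i g x) (hfg : Integrable fun x => f x * g x)
    (hf : Differentiable ℝ f) (hg : Differentiable ℝ g) :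
    ∫ x, f x * pd i g x = - ∫ x, pd i f x * g x :=
  integral_mul_fderiv_eq_neg_fderiv_mul_of_integrable hf'g hfg' hfg (fun x _ => hf x)
    (fun x _ => hg x)

theorem integral_smooth_mul_pd (hf : Smooth f) (hg : IsTest g) (i : Fin 3) :
    ∫ x, f x * pd i g x = - ∫ x, pd i f x * g x :=
  integral_mul_pd ((hf.pd i).mul_test hg).integrable (hf.mul_test (hg.pd i)).integrable
    (hf.mul_test hg).integrable hf.diff hg.smooth.diff

theorem integral_test_mul_pd (hf : IsTest f) (hg : Smooth g) (i : Fin 3) :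
    ∫ x, f x * pd i g x = - ∫ x, pd i f x * g x :=
  integral_mul_pd ((hf.pd i).mul_smooth hg).integrable (hf.mul_smooth (hg.pd i)).integrable
    (hf.mul_smooth hg).integrable hf.smooth.diff hg.diff

end Caccioppoli

namespace Caccioppoli

/-- The normalised Gaussian `(b/π)^{3/2} exp (-b |z|²)` on `ℝ³`. -/
def gk (b : ℝ) (z : E3) : ℝ := (b / Real.pi) ^ (3 / 2 : ℝ) * Real.exp (-b * ‖z‖ ^ 2)

/-- The Gaussian average `∫ gk b z f (x + s z) dz`. -/
def ev (b s : ℝ) (f : E3 → ℝ) (x : E3) : ℝ := ∫ z, gk b z * f (x + s • z)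

/-- An integrable weight on `ℝ³`. -/
def wt (x : E3) : ℝ := ((1 + ‖x‖) ^ 4)⁻¹

variable {b : ℝ} {f g : E3 → ℝ} {i j : Fin 3}

theorem gk_nonneg (hb : 0 < b) (z : E3) : 0 ≤ gk b z := by unfold gk; positivity

theorem gk_neg (b : ℝ) (z : E3) : gk b (-z) = gk b z := by simp [gk]

theorem smooth_gk (b : ℝ) : Smooth (gk b) :=
  contDiff_const.mul (Real.contDiff_exp.comp (contDiff_const.mul (contDiff_norm_sq ℝ)))

theorem continuous_gk (b : ℝ) : Continuous (gk b) := (smooth_gk b).continuous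

theorem integral_gk (hb : 0 < b) : ∫ z, gk b z = 1 := by
  simp only [gk]
  rw [integral_const_mul, GaussianFourier.integral_rexp_neg_mul_sq_norm hb]
  simp only [finrank_euclideanSpace, Fintype.card_fin]
  have h : b / Real.pi * (Real.pi / b) = 1 := by field_simp
  rw [show (((3 : ℕ) : ℝ) / 2) = (3 / 2 : ℝ) by norm_num,
    ← Real.mul_rpow (by positivity) (by positivity), h, Real.one_rpow]

theorem wt_nonneg (x : E3) : 0 ≤ wt x := by unfold wt; positivity

theorem wt_le_one (x : E3) : wt x ≤ 1 := by
  unfold wt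
  exact inv_le_one_of_one_le₀ (one_le_pow₀ (by simp))

theorem integrable_wt : Integrable wt := by
  have := integrable_one_add_norm (E := E3) (μ := volume) (r := 4) (by simp; norm_num)
  refine this.congr (ae_of_all _ fun x => ?_)
  simp only [wt]
  rw [Real.rpow_neg (by positivity)]
  norm_cast

theorem integrable_moment (hb : 0 < b) : Integrable fun z : E3 => (1 + ‖z‖) ^ 4 * gk b z := by
  have hcont : Continuous fun z : E3 => (1 + ‖z‖) ^ 4 * gk b z :=
    (by fun_prop : Continuous fun z : E3 => (1 + ‖z‖) ^ 4).mul (continuous_gk b)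
  set K : ℝ := 40320 * (b ^ 8)⁻¹ * Real.exp (3 / 2 * b) * (b / Real.pi) ^ (3 / 2 : ℝ)
  refine (integrable_wt.const_mul K).mono' hcont.aestronglyMeasurable (ae_of_all _ fun z => ?_)
  have hn : 0 ≤ ‖z‖ := norm_nonneg z
  have h8 : (1 + ‖z‖) ^ 8 ≤ 40320 * (b ^ 8)⁻¹ * Real.exp (b * (1 + ‖z‖)) := by
    have := Real.pow_div_factorial_le_exp (b * (1 + ‖z‖)) (by positivity) 8
    rw [show (Nat.factorial 8 : ℝ) = 40320 by norm_num [Nat.factorial], mul_pow] at this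
    rw [div_le_iff₀ (by norm_num)] at this
    have hb8 : 0 < b ^ 8 := by positivity
    calc (1 + ‖z‖) ^ 8 = (b ^ 8)⁻¹ * (b ^ 8 * (1 + ‖z‖) ^ 8) := by field_simp
      _ ≤ (b ^ 8)⁻¹ * (Real.exp (b * (1 + ‖z‖)) * 40320) := by gcongr
      _ = _ := by ring
  have hexp : Real.exp (b * (1 + ‖z‖)) * Real.exp (-b * ‖z‖ ^ 2) ≤ Real.exp (3 / 2 * b) := by
    rw [← Real.exp_add]
    apply Real.exp_le_exp.2
    nlinarith [mul_nonneg hb.le (sq_nonneg (‖z‖ - 1)), mul_nonneg hb.le (sq_nonneg ‖z‖)]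
  have hpos : 0 < (1 + ‖z‖) ^ 4 := by positivity
  rw [Real.norm_of_nonneg (mul_nonneg hpos.le (gk_nonneg hb z)), wt, ← div_eq_mul_inv,
    le_div_iff₀ hpos]
  calc (1 + ‖z‖) ^ 4 * gk b z * (1 + ‖z‖) ^ 4
      = (1 + ‖z‖) ^ 8 * Real.exp (-b * ‖z‖ ^ 2) * (b / Real.pi) ^ (3 / 2 : ℝ) := by
        unfold gk; ring
    _ ≤ 40320 * (b ^ 8)⁻¹ * Real.exp (b * (1 + ‖z‖)) * Real.exp (-b * ‖z‖ ^ 2)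
        * (b / Real.pi) ^ (3 / 2 : ℝ) := by gcongr
    _ = 40320 * (b ^ 8)⁻¹ * (Real.exp (b * (1 + ‖z‖)) * Real.exp (-b * ‖z‖ ^ 2))
        * (b / Real.pi) ^ (3 / 2 : ℝ) := by ring
    _ ≤ K := by simp only [K]; gcongr

theorem integrable_gk (hb : 0 < b) : Integrable (gk b) := by
  refine (integrable_moment hb).mono' (continuous_gk b).aestronglyMeasurable
    (ae_of_all _ fun z => ?_)
  rw [Real.norm_of_nonneg (gk_nonneg hb z)]
  exact le_mul_of_one_le_left (gk_nonneg hb z) (one_le_pow₀ (by simp))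

theorem integrable_norm_mul_gk (hb : 0 < b) : Integrable fun z : E3 => ‖z‖ * gk b z := by
  refine (integrable_moment hb).mono' (continuous_norm.mul (continuous_gk b)).aestronglyMeasurable
    (ae_of_all _ fun z => ?_)
  rw [Real.norm_of_nonneg (mul_nonneg (norm_nonneg _) (gk_nonneg hb z))]
  refine mul_le_mul_of_nonneg_right ?_ (gk_nonneg hb z)
  calc ‖z‖ ≤ 1 + ‖z‖ := by simp
    _ ≤ (1 + ‖z‖) ^ 4 := le_self_pow₀ (by simp) (by norm_num)

theorem abs_coord_le_norm (z : E3) (i : Fin 3) : |z i| ≤ ‖z‖ := PiLp.norm_apply_le z i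

theorem pd_gk (b : ℝ) (i : Fin 3) (z : E3) : pd i (gk b) z = -2 * b * z i * gk b z := by
  have h1 : HasFDerivAt (fun z : E3 => ‖z‖ ^ 2) (2 • innerSL ℝ z) z :=
    (hasStrictFDerivAt_norm_sq z).hasFDerivAt
  have h2 := ((h1.const_mul (-b)).exp).const_mul ((b / Real.pi) ^ (3 / 2 : ℝ))
  have h3 : fderiv ℝ (gk b) z = _ := h2.fderiv
  simp only [pd]
  rw [h3]
  have : inner ℝ z (bv i) = z i := by
    simp [EuclideanSpace.inner_single_right]
  simp [gk, this]
  ring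

protected theorem IsTest.integrable_gk_mul (hb : 0 < b) (hf : IsTest f) (s : ℝ) (x : E3) :
    Integrable fun z => gk b z * f (x + s • z) := by
  obtain ⟨C, hC0, hC⟩ := hf.bounded
  refine (integrable_gk hb).mul_bdd (c := C) ?_ (ae_of_all _ fun z => hC _)
  exact (hf.continuous.comp (by fun_prop)).aestronglyMeasurable

protected theorem IsTest.integrable_coord_mul (hb : 0 < b) (hf : IsTest f) (s : ℝ) (x : E3) (i : Fin 3) :
    Integrable fun z : E3 => z i * gk b z * f (x + s • z) := by
  obtain ⟨C, hC0, hC⟩ := hf.bounded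
  refine Integrable.mul_bdd (c := C) ?_
    (hf.continuous.comp (by fun_prop)).aestronglyMeasurable (ae_of_all _ fun z => hC _)
  have hc : Continuous fun z : E3 => z i := by fun_prop
  refine (integrable_norm_mul_gk hb).mono' (hc.mul (continuous_gk b)).aestronglyMeasurable
    (ae_of_all _ fun z => ?_)
  rw [norm_mul, Real.norm_of_nonneg (gk_nonneg hb z)]
  exact mul_le_mul_of_nonneg_right (abs_coord_le_norm z i) (gk_nonneg hb z)

protected theorem IsTest.le_wt (hf : IsTest f) : ∃ C, 0 ≤ C ∧ ∀ x, |f x| ≤ C * wt x := by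
  have hc : Continuous fun x : E3 => (1 + ‖x‖) ^ 4 * f x :=
    (by fun_prop : Continuous fun z : E3 => (1 + ‖z‖) ^ 4).mul hf.continuous
  obtain ⟨C, hC⟩ := hc.bounded_above_of_compact_support hf.compact.mul_left
  refine ⟨C, (norm_nonneg _).trans (hC 0), fun x => ?_⟩
  have hpos : 0 < (1 + ‖x‖) ^ 4 := by positivity
  have := hC x
  rw [norm_mul, Real.norm_of_nonneg hpos.le, Real.norm_eq_abs] at this
  rw [wt, ← div_eq_mul_inv, le_div_iff₀ hpos]
  linarith

theorem wt_add_smul_le {s : ℝ} (hs : s ∈ Set.Icc (0 : ℝ) 1) (x z : E3) :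
    wt (x + s • z) ≤ wt x * (1 + ‖z‖) ^ 4 := by
  have h1 : 1 + ‖x‖ ≤ (1 + ‖x + s • z‖) * (1 + ‖z‖) := by
    have h2 : ‖x‖ ≤ ‖x + s • z‖ + ‖z‖ := by
      calc ‖x‖ = ‖(x + s • z) - s • z‖ := by simp
        _ ≤ ‖x + s • z‖ + ‖s • z‖ := norm_sub_le _ _
        _ ≤ ‖x + s • z‖ + ‖z‖ := by
          rw [norm_smul, Real.norm_of_nonneg hs.1]
          nlinarith [norm_nonneg z, hs.2]
    nlinarith [norm_nonneg z, norm_nonneg (x + s • z)]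
  have h3 : wt (x + s • z) ≤ wt x * (1 + ‖z‖) ^ 4 := by
    unfold wt
    rw [inv_mul_eq_div, le_div_iff₀ (by positivity), inv_mul_eq_div,
      div_le_iff₀ (by positivity), ← mul_pow, mul_comm (1 + ‖z‖)]
    gcongr
  exact h3

protected theorem IsTest.ev_le_wt (hb : 0 < b) (hf : IsTest f) :
    ∃ C, 0 ≤ C ∧ ∀ s ∈ Set.Icc (0 : ℝ) 1, ∀ x, |ev b s f x| ≤ C * wt x := by
  obtain ⟨C, hC0, hC⟩ := hf.le_wt
  refine ⟨C * ∫ z : E3, (1 + ‖z‖) ^ 4 * gk b z,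
    mul_nonneg hC0 (integral_nonneg fun z => mul_nonneg (by positivity) (gk_nonneg hb z)), ?_⟩
  intro s hs x
  have hpt : ∀ z : E3, |gk b z * f (x + s • z)| ≤ C * wt x * ((1 + ‖z‖) ^ 4 * gk b z) := by
    intro z
    rw [abs_mul, abs_of_nonneg (gk_nonneg hb z)]
    have h3 := wt_add_smul_le hs x z
    calc gk b z * |f (x + s • z)| ≤ gk b z * (C * (wt x * (1 + ‖z‖) ^ 4)) := by
          gcongr
          · exact gk_nonneg hb z
          · exact (hC _).trans (by gcongr)
      _ = _ := by ring
  calc |ev b s f x| ≤ ∫ z, |gk b z * f (x + s • z)| := abs_integral_le_integral_abs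
    _ ≤ ∫ z : E3, C * wt x * ((1 + ‖z‖) ^ 4 * gk b z) :=
      integral_mono (hf.integrable_gk_mul hb s x).abs ((integrable_moment hb).const_mul _) hpt
    _ = _ := by rw [integral_const_mul]; ring

protected theorem IsTest.continuous_ev (hb : 0 < b) (hf : IsTest f) :
    Continuous fun q : ℝ × E3 => ev b q.1 f q.2 := by
  obtain ⟨C, hC0, hC⟩ := hf.bounded
  have hfc := hf.continuous
  have hgc := continuous_gk b
  refine continuous_of_dominated (bound := fun z => C * gk b z) ?_ ?_
    ((integrable_gk hb).const_mul C) ?_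
  · intro q
    exact (hf.integrable_gk_mul hb _ _).aestronglyMeasurable
  · intro q
    refine ae_of_all _ fun z => ?_
    rw [norm_mul, Real.norm_of_nonneg (gk_nonneg hb z), mul_comm]
    exact mul_le_mul_of_nonneg_right (hC _) (gk_nonneg hb z)
  · exact ae_of_all _ fun z => by fun_prop

protected theorem IsTest.hasFDerivAt_ev (hb : 0 < b) (hf : IsTest f) (s : ℝ) (x : E3) :
    HasFDerivAt (ev b s f) (∫ z, gk b z • fderiv ℝ f (x + s • z)) x := by
  have hfd : Continuous (fderiv ℝ f) := hf.smooth.continuous_fderiv (by simp)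
  obtain ⟨C, hC⟩ := hfd.bounded_above_of_compact_support (hf.compact.fderiv (𝕜 := ℝ))
  have hgc := continuous_gk b
  refine hasFDerivAt_integral_of_dominated_of_fderiv_le (s := Set.univ) (x₀ := x)
    (F := fun y z => gk b z * f (y + s • z)) (F' := fun y z => gk b z • fderiv ℝ f (y + s • z))
    (bound := fun z => C * gk b z) Filter.univ_mem ?_ (hf.integrable_gk_mul hb s x) ?_ ?_
    ((integrable_gk hb).const_mul C) ?_
  · exact Eventually.of_forall fun y => (hf.integrable_gk_mul hb s y).aestronglyMeasurable
  · exact Continuous.aestronglyMeasurable (by fun_prop)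
  · refine ae_of_all _ fun z y _ => ?_
    rw [norm_smul, Real.norm_of_nonneg (gk_nonneg hb z), mul_comm]
    exact mul_le_mul_of_nonneg_right (hC _) (gk_nonneg hb z)
  · refine ae_of_all _ fun z y _ => ?_
    have h := (hf.smooth.diff (y + s • z)).hasFDerivAt.comp y
      ((hasFDerivAt_id y).add_const (s • z))
    exact h.const_mul (gk b z)

protected theorem IsTest.differentiable_ev (hb : 0 < b) (hf : IsTest f) (s : ℝ) :
    Differentiable ℝ (ev b s f) := fun x => (hf.hasFDerivAt_ev hb s x).differentiableAt

protected theorem IsTest.pd_ev (hb : 0 < b) (hf : IsTest f) (s : ℝ) :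
    pd i (ev b s f) = ev b s (pd i f) := by
  funext x
  have hfd : Continuous (fderiv ℝ f) := hf.smooth.continuous_fderiv (by simp)
  obtain ⟨C, hC⟩ := hfd.bounded_above_of_compact_support (hf.compact.fderiv (𝕜 := ℝ))
  have hgc := continuous_gk b
  have hint : Integrable fun z => gk b z • fderiv ℝ f (x + s • z) := by
    refine ((integrable_gk hb).const_mul C).mono'
      (Continuous.aestronglyMeasurable (by fun_prop)) (ae_of_all _ fun z => ?_)
    rw [norm_smul, Real.norm_of_nonneg (gk_nonneg hb z), mul_comm]
    exact mul_le_mul_of_nonneg_right (hC _) (gk_nonneg hb z)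
  rw [pd, (hf.hasFDerivAt_ev hb s x).fderiv, ContinuousLinearMap.integral_apply hint]
  rfl

protected theorem IsTest.hasDerivAt_ev (hb : 0 < b) (hf : IsTest f) (s : ℝ) (x : E3) :
    HasDerivAt (fun t => ev b t f x) (s / (2 * b) * ev b s (lapl f) x) s := by
  have hfd : Continuous (fderiv ℝ f) := hf.smooth.continuous_fderiv (by simp)
  obtain ⟨C, hC⟩ := hfd.bounded_above_of_compact_support (hf.compact.fderiv (𝕜 := ℝ))
  have hgc := continuous_gk b
  have key : HasDerivAt (fun t => ev b t f x) (∫ z, gk b z * fderiv ℝ f (x + s • z) z) s := by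
    refine (hasDerivAt_integral_of_dominated_loc_of_deriv_le (s := Set.univ)
      (F' := fun t z => gk b z * fderiv ℝ f (x + t • z) z)
      (bound := fun z => C * (‖z‖ * gk b z)) Filter.univ_mem ?_ (hf.integrable_gk_mul hb s x) ?_ ?_
      ((integrable_norm_mul_gk hb).const_mul C) ?_).2
    · exact Eventually.of_forall fun t => (hf.integrable_gk_mul hb t x).aestronglyMeasurable
    · exact Continuous.aestronglyMeasurable (by fun_prop)
    · refine ae_of_all _ fun z t _ => ?_
      rw [norm_mul, Real.norm_of_nonneg (gk_nonneg hb z)]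
      calc gk b z * ‖fderiv ℝ f (x + t • z) z‖ ≤ gk b z * (C * ‖z‖) := by
            gcongr
            · exact gk_nonneg hb z
            · exact (ContinuousLinearMap.le_opNorm _ _).trans (by gcongr; exact hC _)
        _ = _ := by ring
    · refine ae_of_all _ fun z t _ => ?_
      have h1 : HasDerivAt (fun t : ℝ => x + t • z) z t := by
        simpa using ((hasDerivAt_id t).smul_const z).const_add x
      exact ((hf.smooth.diff (x + t • z)).hasFDerivAt.comp_hasDerivAt t h1).const_mul (gk b z)
  convert key using 1
  have h1 : ∀ z, gk b z * fderiv ℝ f (x + s • z) z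
      = ∑ i, z i * gk b z * pd i f (x + s • z) := by
    intro z
    rw [fderiv_eq_sum_pd, Finset.mul_sum]
    exact Finset.sum_congr rfl fun i _ => by ring
  simp_rw [h1]
  rw [integral_finsetSum _ fun i _ => (hf.pd i).integrable_coord_mul hb s x i]
  have h2 : ∀ i, ∫ z : E3, z i * gk b z * pd i f (x + s • z)
      = s / (2 * b) * ev b s (pd i (pd i f)) x := by
    intro i
    have hs : Smooth fun z : E3 => pd i f (x + s • z) :=
      (hf.smooth.pd i).comp (contDiff_const.add (contDiff_id.const_smul s))
    have hpd : ∀ z, pd i (fun z : E3 => pd i f (x + s • z)) z = s * pd i (pd i f) (x + s • z) :=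
      fun z => pd_scale (hf.smooth.pd i) x z s
    have hI1 := ((hf.pd i).integrable_coord_mul hb s x i).const_mul (-2 * b)
    have hI2 := (((hf.pd i).pd i).integrable_gk_mul hb s x).const_mul s
    have := integral_mul_pd (i := i) (f := gk b) (g := fun z => pd i f (x + s • z))
      (hI1.congr (ae_of_all _ fun z => by simp only [pd_gk]; ring))
      (hI2.congr (ae_of_all _ fun z => by simp only [hpd]; ring))
      ((hf.pd i).integrable_gk_mul hb s x) (smooth_gk b).diff hs.diff
    simp only [hpd, pd_gk] at this
    have e1 : ∫ z, gk b z * (s * pd i (pd i f) (x + s • z)) = s * ev b s (pd i (pd i f)) x := by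
      rw [ev, ← integral_const_mul]
      exact integral_congr_ae (ae_of_all _ fun z => by ring)
    have e2 : ∫ z : E3, -2 * b * z i * gk b z * pd i f (x + s • z)
        = -2 * b * ∫ z : E3, z i * gk b z * pd i f (x + s • z) := by
      rw [← integral_const_mul]
      exact integral_congr_ae (ae_of_all _ fun z => by ring)
    rw [e1, e2] at this
    field_simp
    linarith
  simp_rw [h2]
  rw [← Finset.mul_sum]
  congr 1
  simp only [ev, lapl, Finset.mul_sum]
  rw [integral_finsetSum _ fun i _ => ((hf.pd i).pd i).integrable_gk_mul hb s x]

end Caccioppoli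

namespace Caccioppoli

/-- Continuous functions of `(s, x)` bounded by a multiple of `wt x` for `s ∈ [0, 1]`. -/
structure Decays (a : ℝ → E3 → ℝ) : Prop where
  cont : Continuous fun q : ℝ × E3 => a q.1 q.2
  bound : ∃ C, 0 ≤ C ∧ ∀ s ∈ Set.Icc (0 : ℝ) 1, ∀ x, |a s x| ≤ C * wt x

/-- Continuous functions of `(s, x)` bounded for `s ∈ [0, 1]`. -/
structure Bdd (a : ℝ → E3 → ℝ) : Prop where
  cont : Continuous fun q : ℝ × E3 => a q.1 q.2
  bound : ∃ C, 0 ≤ C ∧ ∀ s ∈ Set.Icc (0 : ℝ) 1, ∀ x, |a s x| ≤ C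

variable {b : ℝ} {f g : E3 → ℝ} {i j : Fin 3} {a c : ℝ → E3 → ℝ}

theorem Decays.bdd (ha : Decays a) : Bdd a := by
  obtain ⟨C, hC0, hC⟩ := ha.bound
  exact ⟨ha.cont, C, hC0, fun s hs x =>
    (hC s hs x).trans (mul_le_of_le_one_right hC0 (wt_le_one x))⟩

protected theorem Decays.add (ha : Decays a) (hc : Decays c) :
    Decays fun s x => a s x + c s x := by
  obtain ⟨C, hC0, hC⟩ := ha.bound
  obtain ⟨D, hD0, hD⟩ := hc.bound
  exact ⟨ha.cont.add hc.cont, C + D, by positivity, fun s hs x =>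
    (abs_add_le _ _).trans (by rw [add_mul]; exact add_le_add (hC s hs x) (hD s hs x))⟩

protected theorem Bdd.add (ha : Bdd a) (hc : Bdd c) : Bdd fun s x => a s x + c s x := by
  obtain ⟨C, hC0, hC⟩ := ha.bound
  obtain ⟨D, hD0, hD⟩ := hc.bound
  exact ⟨ha.cont.add hc.cont, C + D, by positivity, fun s hs x =>
    (abs_add_le _ _).trans (add_le_add (hC s hs x) (hD s hs x))⟩

protected theorem Bdd.mul (ha : Bdd a) (hc : Bdd c) : Bdd fun s x => a s x * c s x := by
  obtain ⟨C, hC0, hC⟩ := ha.bound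
  obtain ⟨D, hD0, hD⟩ := hc.bound
  refine ⟨ha.cont.mul hc.cont, C * D, by positivity, fun s hs x => ?_⟩
  rw [abs_mul]
  exact mul_le_mul (hC s hs x) (hD s hs x) (abs_nonneg _) hC0

protected theorem Decays.mul (ha : Decays a) (hc : Bdd c) : Decays fun s x => a s x * c s x := by
  obtain ⟨C, hC0, hC⟩ := ha.bound
  obtain ⟨D, hD0, hD⟩ := hc.bound
  refine ⟨ha.cont.mul hc.cont, C * D, by positivity, fun s hs x => ?_⟩
  rw [abs_mul, mul_right_comm]
  exact mul_le_mul (hC s hs x) (hD s hs x) (abs_nonneg _) (mul_nonneg hC0 (wt_nonneg x))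

theorem Bdd.of_continuous {h : ℝ → ℝ} (hh : Continuous h) : Bdd fun s _ => h s := by
  obtain ⟨C, hC⟩ := (isCompact_Icc (a := (0 : ℝ)) (b := 1)).exists_bound_of_continuousOn
    hh.continuousOn
  exact ⟨hh.comp continuous_fst, C, (norm_nonneg _).trans (hC 0 (by simp)),
    fun s hs _ => hC s hs⟩

theorem Bdd.const (k : ℝ) : Bdd fun _ _ => k := Bdd.of_continuous continuous_const

protected theorem Decays.abs (ha : Decays a) : Decays fun s x => |a s x| :=
  ⟨ha.cont.abs, by simpa using ha.bound⟩

protected theorem Decays.sum {A : Fin 3 → ℝ → E3 → ℝ} (h : ∀ k, Decays (A k)) :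
    Decays fun s x => ∑ k, A k s x := by
  simp only [Fin.sum_univ_three]
  exact ((h 0).add (h 1)).add (h 2)

theorem Decays.integrable (ha : Decays a) {s : ℝ} (hs : s ∈ Set.Icc (0 : ℝ) 1) :
    Integrable (a s) := by
  obtain ⟨C, hC0, hC⟩ := ha.bound
  exact (integrable_wt.const_mul C).mono'
    (ha.cont.comp (by fun_prop : Continuous fun x : E3 => (s, x))).aestronglyMeasurable
    (ae_of_all _ fun x => hC s hs x)

theorem Decays.integrable_prod (ha : Decays a) :
    Integrable (fun q : ℝ × E3 => a q.1 q.2)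
      ((volume.restrict (Set.Ioc (0 : ℝ) 1)).prod volume) := by
  obtain ⟨C, hC0, hC⟩ := ha.bound
  have h1 : Integrable (fun q : ℝ × E3 => (1 : ℝ) * (C * wt q.2))
      ((volume.restrict (Set.Ioc (0 : ℝ) 1)).prod volume) :=
    Integrable.mul_prod (f := fun _ : ℝ => (1 : ℝ)) (g := fun x => C * wt x)
      (integrable_const _) (integrable_wt.const_mul C)
  refine h1.mono' ha.cont.aestronglyMeasurable ?_
  have : ∀ᵐ q : ℝ × E3 ∂((volume.restrict (Set.Ioc (0 : ℝ) 1)).prod volume),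
      q.1 ∈ Set.Ioc (0 : ℝ) 1 :=
    Measure.quasiMeasurePreserving_fst.ae (ae_restrict_mem measurableSet_Ioc)
  filter_upwards [this] with q hq
  rw [one_mul]
  exact hC q.1 ⟨hq.1.le, hq.2⟩ q.2

theorem Decays.integral_swap (ha : Decays a) :
    ∫ x, ∫ s in (0 : ℝ)..1, a s x = ∫ s in (0 : ℝ)..1, ∫ x, a s x := by
  simp only [intervalIntegral.integral_of_le zero_le_one]
  rw [MeasureTheory.integral_integral_swap]
  exact ha.integrable_prod.swap

theorem Decays.intervalIntegrable (ha : Decays a) :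
    IntervalIntegrable (fun s => ∫ x, a s x) volume 0 1 := by
  rw [intervalIntegrable_iff_integrableOn_Ioc_of_le zero_le_one]
  exact ha.integrable_prod.integral_prod_left

protected theorem IsTest.decays_ev (hb : 0 < b) (hf : IsTest f) : Decays fun s x => ev b s f x :=
  ⟨hf.continuous_ev hb, hf.ev_le_wt hb⟩

theorem ev_zero (hb : 0 < b) (f : E3 → ℝ) (x : E3) : ev b 0 f x = f x := by
  simp [ev, integral_mul_const, integral_gk hb]

theorem ev_nonneg (hb : 0 < b) (hg : ∀ x, 0 ≤ g x) (s : ℝ) (x : E3) : 0 ≤ ev b s g x :=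
  integral_nonneg fun z => mul_nonneg (gk_nonneg hb z) (hg _)

/-- Jensen's inequality for the Gaussian averages. -/
theorem ev_sq_le (hb : 0 < b) (hf : IsTest f) (hg : IsTest g) (hfg : ∀ x, f x ^ 2 ≤ g x)
    (s : ℝ) (x : E3) : ev b s f x ^ 2 ≤ ev b s g x := by
  set m := ev b s f x with hm
  have h1 : 0 ≤ ∫ z, (gk b z * g (x + s • z) - 2 * m * (gk b z * f (x + s • z))
      + m ^ 2 * gk b z) := by
    refine integral_nonneg fun z => ?_
    have h := mul_nonneg (gk_nonneg hb z) (sq_nonneg (f (x + s • z) - m))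
    have h' := mul_le_mul_of_nonneg_left (hfg (x + s • z)) (gk_nonneg hb z)
    simp only [Pi.zero_apply]
    nlinarith
  rw [integral_add, integral_sub, integral_const_mul, integral_const_mul, integral_gk hb] at h1
  · change 0 ≤ ev b s g x - 2 * m * m + m ^ 2 * 1 at h1
    nlinarith
  · exact hg.integrable_gk_mul hb s x
  · exact (hf.integrable_gk_mul hb s x).const_mul _
  · exact (hg.integrable_gk_mul hb s x).sub ((hf.integrable_gk_mul hb s x).const_mul _)
  · exact (integrable_gk hb).const_mul _

end Caccioppoli

namespace Caccioppoli

variable {f g : E3 → ℝ} {i j : Fin 3}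

theorem half_pos' : (0 : ℝ) < 1 / 2 := by norm_num

theorem bellman_initial {a v e : ℝ} (he : 0 < e) (hv : 0 ≤ v) (ha : a ^ 2 ≤ v) :
    a ^ 2 * √(e ^ 2 + v) + 3 * (√(e ^ 2 + v) ^ 3 - e ^ 3 - 3 / 2 * e * v)
      ≤ 4 * (v * √v) + e * v := by
  set r := √(e ^ 2 + v) with hr
  set q := √v with hq
  have hr2 : r ^ 2 = e ^ 2 + v := Real.sq_sqrt (by positivity)
  have hq2 : q ^ 2 = v := Real.sq_sqrt hv
  have hq0 : 0 ≤ q := Real.sqrt_nonneg _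
  have hr0 : 0 ≤ r := Real.sqrt_nonneg _
  have hre : e ≤ r := by nlinarith
  have hrq : r ≤ q + e := by nlinarith [mul_nonneg hq0 he.le]
  have h1 : a ^ 2 * r ≤ v * (q + e) := mul_le_mul ha hrq hr0 hv
  have h2 : r ^ 3 - e ^ 3 - 3 / 2 * e * v = (r - e) ^ 2 * (r + e / 2) := by
    rw [show v = r ^ 2 - e ^ 2 by linarith]; ring
  have h3 : (r - e) ^ 2 * (r + e / 2) ≤ v * q := by
    calc (r - e) ^ 2 * (r + e / 2) ≤ (r - e) ^ 2 * (r + e) := by gcongr; linarith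
      _ = (r - e) * (r ^ 2 - e ^ 2) := by ring
      _ = (r - e) * v := by rw [hr2]; ring
      _ ≤ q * v := by gcongr; linarith
      _ = v * q := mul_comm _ _
  rw [h2]
  linarith

theorem bellman_final {a v e : ℝ} (he : 0 < e) (hv : 0 ≤ v) :
    0 ≤ a ^ 2 * √(e ^ 2 + v) + 3 * (√(e ^ 2 + v) ^ 3 - e ^ 3 - 3 / 2 * e * v) := by
  set r := √(e ^ 2 + v) with hr
  have hr2 : r ^ 2 = e ^ 2 + v := Real.sq_sqrt (by positivity)
  have hr0 : 0 ≤ r := Real.sqrt_nonneg _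
  have h2 : r ^ 3 - e ^ 3 - 3 / 2 * e * v = (r - e) ^ 2 * (r + e / 2) := by
    rw [show v = r ^ 2 - e ^ 2 by linarith]; ring
  rw [h2]
  positivity

theorem bellman_quadratic {F r x y : ℝ} (hr : 0 < r) (hF : F ^ 2 ≤ r ^ 2) :
    r * x ^ 2 + y ^ 2 / r ≤
      (2 * x * r + F * y / r) * x + (F * x / r - F ^ 2 * y / (4 * r ^ 3) + 9 / 4 * y / r) * y := by
  obtain ⟨t, rfl⟩ : ∃ t, F = t * r := ⟨F / r, by field_simp⟩
  obtain ⟨z, rfl⟩ : ∃ z, y = z * r := ⟨y / r, by field_simp⟩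
  have ht : t ^ 2 ≤ 1 := by
    have : 0 < r ^ 2 := by positivity
    nlinarith
  have h1 : (2 * x * r + t * r * (z * r) / r) * x
      + (t * r * x / r - (t * r) ^ 2 * (z * r) / (4 * r ^ 3) + 9 / 4 * (z * r) / r) * (z * r)
      = r * (2 * x ^ 2 + 2 * t * x * z + (9 / 4 - t ^ 2 / 4) * z ^ 2) := by
    field_simp
    ring
  have h2 : r * x ^ 2 + (z * r) ^ 2 / r = r * (x ^ 2 + z ^ 2) := by field_simp
  rw [h1, h2]
  refine mul_le_mul_of_nonneg_left ?_ hr.le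
  nlinarith [sq_nonneg (x + t * z), mul_nonneg (sub_nonneg.2 ht) (sq_nonneg z)]

theorem two_abs_mul_le {r x y : ℝ} (hr : 0 < r) : 2 * (|x| * |y|) ≤ r * x ^ 2 + y ^ 2 / r := by
  obtain ⟨z, rfl⟩ : ∃ z, y = z * r := ⟨y / r, by field_simp⟩
  have h2 : r * x ^ 2 + (z * r) ^ 2 / r = r * (|x| ^ 2 + |z| ^ 2) := by
    rw [sq_abs, sq_abs]; field_simp
  rw [h2, abs_mul, abs_of_pos hr]
  nlinarith [mul_nonneg hr.le (sq_nonneg (|x| - |z|))]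

protected theorem IsTest.hasDerivAt_ev_half (hf : IsTest f) (s : ℝ) (x : E3) :
    HasDerivAt (fun t => ev (1 / 2) t f x) (s * ev (1 / 2) s (lapl f) x) s := by
  have := hf.hasDerivAt_ev half_pos' s x
  norm_num at this ⊢
  exact this

theorem ev_lapl {b : ℝ} (hb : 0 < b) (hf : IsTest f) (s : ℝ) (x : E3) :
    ev b s (lapl f) x = ∑ i, pd i (fun y => ev b s (pd i f) y) x := by
  simp only [ev, lapl, Finset.mul_sum]
  rw [integral_finsetSum _ fun i _ => ((hf.pd i).pd i).integrable_gk_mul hb s x]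
  refine Finset.sum_congr rfl fun i _ => ?_
  have := congrFun ((hf.pd i).pd_ev (i := i) hb s) x
  exact this.symm

theorem hasDerivAt_line (hf : Differentiable ℝ f) (i : Fin 3) (x : E3) :
    HasDerivAt (fun t : ℝ => f (x + t • bv i)) (pd i f x) 0 := by
  have h1 : HasDerivAt (fun t : ℝ => x + t • bv i) (bv i) 0 := by
    simpa using ((hasDerivAt_id (0 : ℝ)).smul_const (bv i)).const_add x
  have h2 : HasFDerivAt f (fderiv ℝ f x) (x + (0 : ℝ) • bv i) := by
    simpa using (hf x).hasFDerivAt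
  exact h2.comp_hasDerivAt 0 h1

theorem pd_eq_of_hasDerivAt_line (hf : Differentiable ℝ f) {x : E3} {d : ℝ}
    (h : HasDerivAt (fun t : ℝ => f (x + t • bv i)) d 0) : pd i f x = d :=
  (hasDerivAt_line hf i x).unique h

/-- A bilinear estimate for heat extensions, by the Bellman function method. -/
theorem bellman_bilinear_aux (hf : IsTest f) (hg : IsTest g) (hfg : ∀ x, f x ^ 2 ≤ g x)
    (i j : Fin 3) {e : ℝ} (he : 0 < e) :
    ∫ s in (0 : ℝ)..1, ∫ x, 2 * s * (|ev (1 / 2) s (pd j f) x| * |ev (1 / 2) s (pd i g) x|)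
      ≤ ∫ x, (4 * (g x * √(g x)) + e * g x) := by
  have hb := half_pos'
  have hg0 : ∀ x, 0 ≤ g x := fun x => (sq_nonneg _).trans (hfg x)
  set F : ℝ → E3 → ℝ := fun s x => ev (1 / 2) s f x with hF
  set G : ℝ → E3 → ℝ := fun s x => ev (1 / 2) s g x with hG
  set Fi : Fin 3 → ℝ → E3 → ℝ := fun k s x => ev (1 / 2) s (pd k f) x with hFi
  set Gi : Fin 3 → ℝ → E3 → ℝ := fun k s x => ev (1 / 2) s (pd k g) x with hGi
  set LF : ℝ → E3 → ℝ := fun s x => ev (1 / 2) s (lapl f) x with hLF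
  set LG : ℝ → E3 → ℝ := fun s x => ev (1 / 2) s (lapl g) x with hLG
  set r : ℝ → E3 → ℝ := fun s x => √(e ^ 2 + G s x) with hr
  have G0 : ∀ s x, 0 ≤ G s x := fun s x => ev_nonneg hb hg0 s x
  have harg : ∀ s x, 0 < e ^ 2 + G s x := fun s x => by have := G0 s x; positivity
  have r0 : ∀ s x, 0 < r s x := fun s x => Real.sqrt_pos.2 (harg s x)
  have r2 : ∀ s x, r s x ^ 2 = e ^ 2 + G s x := fun s x => Real.sq_sqrt (harg s x).le
  have er : ∀ s x, e ≤ r s x := fun s x => by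
    have := r2 s x; have := G0 s x; have := r0 s x; nlinarith
  have FG : ∀ s x, F s x ^ 2 ≤ r s x ^ 2 := fun s x => by
    rw [r2]; have : F s x ^ 2 ≤ G s x := ev_sq_le hb hf hg hfg s x
    nlinarith [sq_nonneg e]
  have dF : Decays F := hf.decays_ev hb
  have dG : Decays G := hg.decays_ev hb
  have dFi : ∀ k, Decays (Fi k) := fun k => (hf.pd k).decays_ev hb
  have dGi : ∀ k, Decays (Gi k) := fun k => (hg.pd k).decays_ev hb
  have dLF : Decays LF := hf.lapl.decays_ev hb
  have dLG : Decays LG := hg.lapl.decays_ev hb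
  have br : Bdd r := by
    obtain ⟨C, hC0, hC⟩ := dG.bdd.bound
    refine ⟨(continuous_const.add dG.cont).sqrt, √(e ^ 2 + C), by positivity, fun s hs x => ?_⟩
    rw [abs_of_pos (r0 s x)]
    exact Real.sqrt_le_sqrt (by have := (le_abs_self _).trans (hC s hs x); linarith)
  have bri : Bdd fun s x => (r s x)⁻¹ := by
    refine ⟨br.cont.inv₀ fun q => (r0 q.1 q.2).ne', e⁻¹, by positivity, fun s hs x => ?_⟩
    rw [abs_of_pos (inv_pos.2 (r0 s x))]
    exact inv_anti₀ he (er s x)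
  set Q : ℝ → E3 → ℝ := fun s x =>
    F s x ^ 2 * r s x + 3 * (r s x ^ 3 - e ^ 3 - 3 / 2 * e * G s x) with hQ
  set Qs : ℝ → E3 → ℝ := fun s x => s * (2 * F s x * r s x * LF s x
    + (F s x ^ 2 / (2 * r s x) + 9 / 2 * (r s x - e)) * LG s x) with hQs
  have hderiv : ∀ s x, HasDerivAt (fun t => Q t x) (Qs s x) s := by
    intro s x
    have h1 : HasDerivAt (fun t => F t x) (s * LF s x) s := hf.hasDerivAt_ev_half s x
    have h2 : HasDerivAt (fun t => G t x) (s * LG s x) s := hg.hasDerivAt_ev_half s x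
    have h3 : HasDerivAt (fun t => r t x) (s * LG s x / (2 * r s x)) s :=
      (h2.const_add (e ^ 2)).sqrt (harg s x).ne'
    have := ((h1.pow 2).mul h3).add ((((h3.pow 3).sub_const (e ^ 3)).sub
      (h2.const_mul (3 / 2 * e))).const_mul 3)
    refine this.congr_deriv ?_
    simp only [hQs]
    have := (r0 s x).ne'
    simp
    field_simp
    ring
  have dQs : Decays Qs := by
    have h := ((dLF.mul ((dF.bdd.mul br).mul (Bdd.const 2))).add
      (dLG.mul (((dF.bdd.mul dF.bdd).mul (bri.mul (Bdd.const 2⁻¹))).add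
        ((br.add (Bdd.const (-e))).mul (Bdd.const (9 / 2)))))).mul (Bdd.of_continuous continuous_id)
    convert h using 3 with s x
    simp only [hQs, id]
    field_simp
    ring
  have hFTC : ∀ x, ∫ s in (0 : ℝ)..1, Qs s x = Q 1 x - Q 0 x := by
    intro x
    refine intervalIntegral.integral_eq_sub_of_hasDerivAt (fun s _ => hderiv s x) ?_
    exact (dQs.cont.comp (by fun_prop : Continuous fun s : ℝ => (s, x))).intervalIntegrable _ _
  have pdF : ∀ s k x, pd k (F s) x = Fi k s x := fun s k x => congrFun (hf.pd_ev hb s) x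
  have pdG : ∀ s k x, pd k (G s) x = Gi k s x := fun s k x => congrFun (hg.pd_ev hb s) x
  have difF : ∀ s, Differentiable ℝ (F s) := fun s => hf.differentiable_ev hb s
  have difG : ∀ s, Differentiable ℝ (G s) := fun s => hg.differentiable_ev hb s
  have difr : ∀ s, Differentiable ℝ (r s) := fun s =>
    ((difG s).const_add (e ^ 2)).sqrt fun x => (harg s x).ne'
  have lF : ∀ s k x, HasDerivAt (fun t : ℝ => F s (x + t • bv k)) (Fi k s x) 0 := fun s k x => by
    rw [← pdF]; exact hasDerivAt_line (difF s) k x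
  have lG : ∀ s k x, HasDerivAt (fun t : ℝ => G s (x + t • bv k)) (Gi k s x) 0 := fun s k x => by
    rw [← pdG]; exact hasDerivAt_line (difG s) k x
  have lr : ∀ s k x, HasDerivAt (fun t : ℝ => r s (x + t • bv k)) (Gi k s x / (2 * r s x)) 0 :=
    fun s k x => by
      have := ((lG s k x).const_add (e ^ 2)).sqrt (by simpa using (harg s x).ne')
      simpa using this
  set A : ℝ → E3 → ℝ := fun s x => 2 * F s x * r s x with hA
  set B : ℝ → E3 → ℝ := fun s x => F s x ^ 2 * (r s x)⁻¹ * (1 / 2) + 9 / 2 * (r s x - e) with hB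
  have difA : ∀ s, Differentiable ℝ (A s) := fun s => ((difF s).const_mul 2).mul (difr s)
  have difB : ∀ s, Differentiable ℝ (B s) := fun s =>
    ((((difF s).pow 2).mul ((difr s).inv fun x => (r0 s x).ne')).mul_const _).add
      (((difr s).sub_const e).const_mul _)
  set Ai : Fin 3 → ℝ → E3 → ℝ := fun k s x =>
    2 * Fi k s x * r s x + F s x * Gi k s x / r s x with hAi
  set Bi : Fin 3 → ℝ → E3 → ℝ := fun k s x => F s x * Fi k s x / r s x
    - F s x ^ 2 * Gi k s x / (4 * r s x ^ 3) + 9 / 4 * Gi k s x / r s x with hBi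
  have pdA : ∀ s k x, pd k (A s) x = Ai k s x := by
    intro s k x
    apply pd_eq_of_hasDerivAt_line (difA s)
    refine (((lF s k x).const_mul 2).mul (lr s k x)).congr_deriv ?_
    have := (r0 s x).ne'
    simp [hAi]
    field_simp
  have pdB : ∀ s k x, pd k (B s) x = Bi k s x := by
    intro s k x
    apply pd_eq_of_hasDerivAt_line (difB s)
    have := (r0 s x).ne'
    refine (((((lF s k x).pow 2).mul ((lr s k x).inv (by simpa using this))).mul_const
      (1 / 2)).add (((lr s k x).sub_const e).const_mul (9 / 2))).congr_deriv ?_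
    simp [hBi]
    field_simp
    ring
  have bA : Bdd A := by
    have h := (dF.bdd.mul br).mul (Bdd.const 2)
    convert h using 3 with s x
    simp only [hA]; ring
  have bB : Bdd B := by
    have h := (((dF.bdd.mul dF.bdd).mul bri).mul (Bdd.const (1 / 2))).add
        ((br.add (Bdd.const (-e))).mul (Bdd.const (9 / 2)))
    convert h using 3 with s x
    simp only [hB]; ring
  have bAi : ∀ k, Bdd (Ai k) := fun k => by
    have h := (((dFi k).bdd.mul br).mul (Bdd.const 2)).add ((dF.bdd.mul (dGi k).bdd).mul bri)
    convert h using 3 with s x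
    simp only [hAi]; ring
  have bBi : ∀ k, Bdd (Bi k) := fun k => by
    have h := (((dF.bdd.mul (dFi k).bdd).mul bri).add
      ((((dF.bdd.mul dF.bdd).mul (dGi k).bdd).mul ((bri.mul bri).mul bri)).mul
        (Bdd.const (-(1 / 4))))).add (((dGi k).bdd.mul bri).mul (Bdd.const (9 / 4)))
    convert h using 3 with s x
    simp only [hBi]
    field_simp
    ring
  set D : ℝ → E3 → ℝ := fun s x => ∑ k, (Ai k s x * Fi k s x + Bi k s x * Gi k s x) with hD
  have ibp : ∀ s ∈ Set.Icc (0 : ℝ) 1, ∀ (a : ℝ → E3 → ℝ) (ai : Fin 3 → ℝ → E3 → ℝ)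
      (h : E3 → ℝ), IsTest h → Bdd a → (∀ k, Bdd (ai k)) → Differentiable ℝ (a s) →
      (∀ k x, pd k (a s) x = ai k s x) →
      ∫ x, a s x * ev (1 / 2) s (lapl h) x
        = - ∑ k, ∫ x, ai k s x * ev (1 / 2) s (pd k h) x := by
    intro s hs a ai h hh ha hai hda hpda
    have e1 : ∀ x, a s x * ev (1 / 2) s (lapl h) x
        = ∑ k, a s x * pd k (ev (1 / 2) s (pd k h)) x := by
      intro x
      rw [ev_lapl hb hh, Finset.mul_sum]
    have i1 : ∀ k, Integrable fun x => a s x * pd k (ev (1 / 2) s (pd k h)) x := by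
      intro k
      rw [(hh.pd k).pd_ev hb]
      exact ((((hh.pd k).pd k).decays_ev hb).mul ha).integrable hs |>.congr
        (ae_of_all _ fun x => mul_comm _ _)
    simp_rw [e1]
    rw [integral_finsetSum _ fun k _ => i1 k, ← Finset.sum_neg_distrib]
    refine Finset.sum_congr rfl fun k _ => ?_
    rw [integral_mul_pd _ (i1 k) _ hda ((hh.pd k).differentiable_ev hb s)]
    · simp_rw [hpda]
    · simp_rw [hpda]
      exact (((hh.pd k).decays_ev hb).mul (hai k)).integrable hs |>.congr
        (ae_of_all _ fun x => mul_comm _ _)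
    · exact (((hh.pd k).decays_ev hb).mul ha).integrable hs |>.congr
        (ae_of_all _ fun x => mul_comm _ _)
  have dAF : ∀ k, Decays fun s x => Ai k s x * Fi k s x := fun k => by
    simpa only [mul_comm] using (dFi k).mul (bAi k)
  have dBG : ∀ k, Decays fun s x => Bi k s x * Gi k s x := fun k => by
    simpa only [mul_comm] using (dGi k).mul (bBi k)
  have dALF : Decays fun s x => A s x * LF s x := by simpa only [mul_comm] using dLF.mul bA
  have dBLG : Decays fun s x => B s x * LG s x := by simpa only [mul_comm] using dLG.mul bB
  have hQsD : ∀ s ∈ Set.Icc (0 : ℝ) 1, ∫ x, Qs s x = - ∫ x, s * D s x := by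
    intro s hs
    have e1 : ∀ x, Qs s x = s * (A s x * LF s x + B s x * LG s x) := by
      intro x
      have := (r0 s x).ne'
      simp only [hQs, hA, hB]
      field_simp
    simp_rw [e1]
    rw [integral_const_mul, integral_const_mul, integral_add (dALF.integrable hs)
      (dBLG.integrable hs), ibp s hs A Ai f hf bA bAi (difA s) (pdA s),
      ibp s hs B Bi g hg bB bBi (difB s) (pdB s)]
    simp only [hD]
    rw [integral_finsetSum _ fun k _ => ((dAF k).add (dBG k)).integrable hs]
    have : ∀ k, ∫ x, (Ai k s x * Fi k s x + Bi k s x * Gi k s x)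
        = (∫ x, Ai k s x * Fi k s x) + ∫ x, Bi k s x * Gi k s x := fun k =>
      integral_add ((dAF k).integrable hs) ((dBG k).integrable hs)
    simp_rw [this]
    rw [Finset.sum_add_distrib]
    ring
  have dD : Decays D := Decays.sum fun k => (dAF k).add (dBG k)
  have dsD : Decays fun s x => s * D s x := by
    simpa only [mul_comm, id] using dD.mul (Bdd.of_continuous continuous_id)
  set T : ℝ → E3 → ℝ := fun s x => 2 * s * (|Fi j s x| * |Gi i s x|) with hT
  have dT : Decays T := by
    have h := ((dFi j).abs.mul (dGi i).abs.bdd).mul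
      ((Bdd.of_continuous continuous_id).mul (Bdd.const 2))
    convert h using 3 with s x
    simp only [hT, id]; ring
  have TD : ∀ s ∈ Set.Icc (0 : ℝ) 1, ∀ x, T s x ≤ s * D s x := by
    intro s hs x
    have h1 : ∀ k, r s x * Fi k s x ^ 2 + Gi k s x ^ 2 / r s x
        ≤ Ai k s x * Fi k s x + Bi k s x * Gi k s x := fun k =>
      bellman_quadratic (r0 s x) (FG s x)
    have h2 : ∑ k, (r s x * Fi k s x ^ 2 + Gi k s x ^ 2 / r s x) ≤ D s x :=
      Finset.sum_le_sum fun k _ => h1 k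
    have hrx := r0 s x
    have h3 : r s x * Fi j s x ^ 2 ≤ ∑ k, r s x * Fi k s x ^ 2 :=
      Finset.single_le_sum (f := fun k => r s x * Fi k s x ^ 2)
        (fun k _ => by positivity) (Finset.mem_univ j)
    have h4 : Gi i s x ^ 2 / r s x ≤ ∑ k, Gi k s x ^ 2 / r s x :=
      Finset.single_le_sum (f := fun k => Gi k s x ^ 2 / r s x)
        (fun k _ => by positivity) (Finset.mem_univ i)
    rw [Finset.sum_add_distrib] at h2
    have h5 := two_abs_mul_le (x := Fi j s x) (y := Gi i s x) hrx
    calc T s x = s * (2 * (|Fi j s x| * |Gi i s x|)) := by simp only [hT]; ring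
      _ ≤ s * D s x := mul_le_mul_of_nonneg_left (by linarith) hs.1
  have hmono : ∀ s ∈ Set.Icc (0 : ℝ) 1, ∫ x, T s x ≤ - ∫ x, Qs s x := by
    intro s hs
    rw [hQsD s hs, neg_neg]
    exact integral_mono (dT.integrable hs) (dsD.integrable hs) (TD s hs)
  calc ∫ s in (0 : ℝ)..1, ∫ x, T s x ≤ ∫ s in (0 : ℝ)..1, - ∫ x, Qs s x :=
        intervalIntegral.integral_mono_on zero_le_one dT.intervalIntegrable
          dQs.intervalIntegrable.neg hmono
    _ = - ∫ x, (Q 1 x - Q 0 x) := by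
        rw [intervalIntegral.integral_neg, ← dQs.integral_swap]
        simp_rw [hFTC]
    _ = ∫ x, (Q 0 x - Q 1 x) := by
        rw [← integral_neg]
        simp
    _ ≤ _ := by
        refine integral_mono ?_ ?_ fun x => ?_
        · have h : Integrable fun x => ∫ s in (0 : ℝ)..1, Qs s x := by
            simp only [intervalIntegral.integral_of_le zero_le_one]
            exact dQs.integrable_prod.integral_prod_right
          refine h.neg.congr (ae_of_all _ fun x => ?_)
          simp [hFTC]
        · exact (((hg.continuous.mul hg.continuous.sqrt).integrable_of_hasCompactSupport
            hg.compact.mul_right).const_mul 4).add (hg.integrable.const_mul e)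
        · have h0 : Q 0 x ≤ 4 * (g x * √(g x)) + e * g x := by
            simp only [hQ, hr, hF, hG, ev_zero hb]
            exact bellman_initial he (hg0 x) (hfg x)
          have h1 : 0 ≤ Q 1 x := bellman_final he (G0 1 x)
          simp only
          linarith

theorem bellman_bilinear (hf : IsTest f) (hg : IsTest g) (hfg : ∀ x, f x ^ 2 ≤ g x)
    (i j : Fin 3) :
    ∫ s in (0 : ℝ)..1, ∫ x, 2 * s * (|ev (1 / 2) s (pd j f) x| * |ev (1 / 2) s (pd i g) x|)
      ≤ 4 * ∫ x, g x * √(g x) := by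
  have h1 : Integrable fun x => g x * √(g x) :=
    (hg.continuous.mul hg.continuous.sqrt).integrable_of_hasCompactSupport hg.compact.mul_right
  have h : ∀ e > 0, ∫ s in (0 : ℝ)..1, ∫ x,
      2 * s * (|ev (1 / 2) s (pd j f) x| * |ev (1 / 2) s (pd i g) x|)
      ≤ 4 * (∫ x, g x * √(g x)) + e * ∫ x, g x := by
    intro e he
    have := bellman_bilinear_aux hf hg hfg i j he
    rwa [integral_add (h1.const_mul 4) (hg.integrable.const_mul e), integral_const_mul,
      integral_const_mul] at this
  have hg0 : 0 ≤ ∫ x, g x := integral_nonneg fun x => (sq_nonneg _).trans (hfg x)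
  refine le_of_forall_pos_le_add fun d hd => (h (d / (1 + ∫ x, g x)) (by positivity)).trans ?_
  gcongr
  rw [div_mul_eq_mul_div, div_le_iff₀ (by positivity)]
  nlinarith

end Caccioppoli

namespace Caccioppoli

variable {f g : E3 → ℝ} {i j : Fin 3}

theorem gk_mul_gk (w z : E3) :
    gk (1 / 2) z * gk (1 / 2) (w - z) = gk (1 / 4) w * gk 1 (z - (1 / 2 : ℝ) • w) := by
  have h1 : ‖w - z‖ ^ 2 = ‖w‖ ^ 2 - 2 * inner ℝ w z + ‖z‖ ^ 2 := norm_sub_sq_real w z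
  have h2 : ‖z - (1 / 2 : ℝ) • w‖ ^ 2 = ‖z‖ ^ 2 - inner ℝ w z + ‖w‖ ^ 2 / 4 := by
    rw [norm_sub_sq_real, norm_smul, inner_smul_right, real_inner_comm]
    norm_num
    ring
  have h3 : (1 / 2 / Real.pi) ^ (3 / 2 : ℝ) * (1 / 2 / Real.pi) ^ (3 / 2 : ℝ)
      = (1 / 4 / Real.pi) ^ (3 / 2 : ℝ) * (1 / Real.pi) ^ (3 / 2 : ℝ) := by
    have := Real.pi_pos
    rw [← Real.mul_rpow (by positivity) (by positivity),
      ← Real.mul_rpow (by positivity) (by positivity)]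
    congr 1
    ring
  unfold gk
  rw [mul_mul_mul_comm, h3, mul_mul_mul_comm _ (Real.exp _) _ (Real.exp (-1 * _)),
    ← Real.exp_add, ← Real.exp_add, h1, h2]
  congr 2
  ring

theorem IsTest.ev_ev (hf : IsTest f) (s : ℝ) (x : E3) :
    ev (1 / 2) s (ev (1 / 2) s f) x = ev (1 / 4) s f x := by
  obtain ⟨C, hC0, hC⟩ := hf.bounded
  have hfc := hf.continuous
  have hgc := continuous_gk (1 / 2)
  have h1 : ∀ z, gk (1 / 2) z * ev (1 / 2) s f (x + s • z)
      = ∫ w, gk (1 / 2) z * gk (1 / 2) (w - z) * f (x + s • w) := by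
    intro z
    rw [ev, ← integral_const_mul,
      ← integral_sub_right_eq_self (fun w => gk (1 / 2) z * (gk (1 / 2) w * f (x + s • z + s • w))) z]
    refine integral_congr_ae (ae_of_all _ fun w => ?_)
    simp only
    rw [smul_sub, mul_assoc]
    congr 3
    abel
  have hint : Integrable (fun q : E3 × E3 => gk (1 / 2) q.1 * gk (1 / 2) (q.2 - q.1)
      * f (x + s • q.2)) (volume.prod volume) := by
    have h0 : Integrable (fun q : E3 × E3 => gk (1 / 2) q.1 * gk (1 / 2) q.2)
        (volume.prod volume) :=
      (integrable_gk half_pos').mul_prod (integrable_gk half_pos')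
    have h2 : Integrable (fun q : E3 × E3 => gk (1 / 2) q.1 * gk (1 / 2) (q.2 - q.1))
        (volume.prod volume) :=
      (measurePreserving_prod_sub volume volume).integrable_comp_of_integrable h0
    exact h2.mul_bdd (c := C) (Continuous.aestronglyMeasurable (by fun_prop))
      (ae_of_all _ fun q => hC _)
  rw [ev]
  simp_rw [h1]
  rw [integral_integral_swap hint, ev]
  refine integral_congr_ae (ae_of_all _ fun w => ?_)
  simp only
  rw [integral_mul_const]
  congr 1
  simp_rw [gk_mul_gk]
  rw [integral_const_mul, integral_sub_right_eq_self (gk 1), integral_gk one_pos, mul_one]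

theorem IsTest.integral_mul_ev {b s : ℝ} (hb : 0 < b) (hs : s ∈ Set.Icc (0 : ℝ) 1)
    (hg : IsTest g) {k : E3 → ℝ} (hk : Continuous k) {C : ℝ} (hC : ∀ x, |k x| ≤ C) :
    ∫ x, g x * ev b s k x = ∫ x, ev b s g x * k x := by
  have hfc := hg.continuous
  have hgc := continuous_gk b
  obtain ⟨D, hD0, hD⟩ := hg.le_wt
  have hint1 : Integrable (fun q : E3 × E3 => gk b q.2 * (g q.1 * k (q.1 + s • q.2)))
      (volume.prod volume) := by
    have h0 : Integrable (fun q : E3 × E3 => g q.1 * gk b q.2) (volume.prod volume) :=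
      hg.integrable.mul_prod (integrable_gk hb)
    refine (h0.mul_bdd (g := fun q => k (q.1 + s • q.2)) (c := C)
      (Continuous.aestronglyMeasurable (by fun_prop)) (ae_of_all _ fun q => hC _)).congr
      (ae_of_all _ fun q => ?_)
    simp only; ring
  have hint2 : Integrable (fun q : E3 × E3 => gk b q.2 * (g (q.1 + s • q.2) * k q.1))
      (volume.prod volume) := by
    have h0 : Integrable (fun q : E3 × E3 => C * D * (wt q.1 * ((1 + ‖q.2‖) ^ 4 * gk b q.2)))
        (volume.prod volume) :=
      (integrable_wt.mul_prod (integrable_moment hb)).const_mul _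
    refine h0.mono' (Continuous.aestronglyMeasurable (by fun_prop)) (ae_of_all _ fun q => ?_)
    rw [norm_mul, norm_mul, Real.norm_of_nonneg (gk_nonneg hb _)]
    have h2 := wt_add_smul_le hs q.1 q.2
    have h3 := gk_nonneg hb q.2
    have h4 := (abs_nonneg _).trans (hC 0)
    calc gk b q.2 * (‖g (q.1 + s • q.2)‖ * ‖k q.1‖)
        ≤ gk b q.2 * (D * (wt q.1 * (1 + ‖q.2‖) ^ 4) * C) := by
          gcongr
          · exact mul_nonneg hD0 (mul_nonneg (wt_nonneg _) (by positivity))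
          · exact (hD _).trans (by gcongr)
          · exact hC _
      _ = _ := by ring
  calc ∫ x, g x * ev b s k x = ∫ x, ∫ z, gk b z * (g x * k (x + s • z)) := by
        refine integral_congr_ae (ae_of_all _ fun x => ?_)
        simp only [ev]
        rw [← integral_const_mul]
        exact integral_congr_ae (ae_of_all _ fun z => by ring)
    _ = ∫ z, ∫ x, gk b z * (g x * k (x + s • z)) := integral_integral_swap hint1
    _ = ∫ z, ∫ x, gk b z * (g (x + s • z) * k x) := by
        rw [← integral_neg_eq_self]
        refine integral_congr_ae (ae_of_all _ fun z => ?_)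
        simp only
        rw [← integral_add_right_eq_self _ (s • z)]
        simp [gk_neg]
    _ = ∫ x, ∫ z, gk b z * (g (x + s • z) * k x) := (integral_integral_swap hint2).symm
    _ = ∫ x, ev b s g x * k x := by
        refine integral_congr_ae (ae_of_all _ fun x => ?_)
        simp only [ev]
        rw [← integral_mul_const]
        exact integral_congr_ae (ae_of_all _ fun z => by ring)

/-- The second-order heat pairing is controlled by the Bellman estimate. -/
theorem abs_heat_pairing_le (hf : IsTest f) (hg : IsTest g) (hfg : ∀ x, f x ^ 2 ≤ g x)
    (i j : Fin 3) :
    |∫ s in (0 : ℝ)..1, 2 * s * ∫ x, f x * ev (1 / 4) s (pd j (pd i g)) x|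
      ≤ 4 * ∫ x, g x * √(g x) := by
  have hb := half_pos'
  have hD := ((hf.pd j).decays_ev hb).abs.mul ((hg.pd i).decays_ev hb).abs.bdd
  have hT : Decays fun s x =>
      2 * s * (|ev (1 / 2) s (pd j f) x| * |ev (1 / 2) s (pd i g) x|) := by
    have h := hD.mul ((Bdd.of_continuous continuous_id).mul (Bdd.const 2))
    convert h using 3 with s x
    simp only [id]; ring
  refine le_trans ?_ (bellman_bilinear hf hg hfg i j)
  rw [← Real.norm_eq_abs]
  refine intervalIntegral.norm_integral_le_of_norm_le zero_le_one ?_ hT.intervalIntegrable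
  refine ae_of_all _ fun s hs => ?_
  have hs' : s ∈ Set.Icc (0 : ℝ) 1 := ⟨hs.1.le, hs.2⟩
  have h1 : ∫ x, f x * ev (1 / 4) s (pd j (pd i g)) x
      = ∫ x, ev (1 / 2) s f x * pd j (ev (1 / 2) s (pd i g)) x := by
    obtain ⟨C, hC0, hC⟩ := (((hg.pd i).pd j).decays_ev hb).bdd.bound
    rw [(hg.pd i).pd_ev hb, ← hf.integral_mul_ev hb hs' (C := C)
      (k := ev (1 / 2) s (pd j (pd i g))) ((((hg.pd i).pd j).continuous_ev hb).comp
        (by fun_prop : Continuous fun x : E3 => (s, x)))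
      (hC s hs')]
    simp_rw [((hg.pd i).pd j).ev_ev]
  have h2 : ∫ x, ev (1 / 2) s f x * pd j (ev (1 / 2) s (pd i g)) x
      = - ∫ x, ev (1 / 2) s (pd j f) x * ev (1 / 2) s (pd i g) x := by
    rw [integral_mul_pd _ _ _ (hf.differentiable_ev hb s) ((hg.pd i).differentiable_ev hb s)]
    · rw [hf.pd_ev hb]
    · rw [hf.pd_ev hb]
      exact (((hf.pd j).decays_ev hb).mul ((hg.pd i).decays_ev hb).bdd).integrable hs'
    · rw [(hg.pd i).pd_ev hb]
      exact ((hf.decays_ev hb).mul (((hg.pd i).pd j).decays_ev hb).bdd).integrable hs'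
    · exact ((hf.decays_ev hb).mul ((hg.pd i).decays_ev hb).bdd).integrable hs'
  rw [h1, h2, norm_mul, norm_neg, Real.norm_of_nonneg (by linarith [hs.1]), integral_const_mul]
  refine mul_le_mul_of_nonneg_left ?_ (by linarith [hs.1])
  refine (norm_integral_le_integral_norm _).trans (le_of_eq ?_)
  refine integral_congr_ae (ae_of_all _ fun x => ?_)
  simp only [norm_mul, Real.norm_eq_abs]

end Caccioppoli

namespace Caccioppoli

variable {f g : E3 → ℝ} {i j : Fin 3} {a c : ℝ → E3 → ℝ}

theorem exists_cutoff {r R : ℝ} (hr : 0 < r) (hR : r < R) :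
    ∃ θ : E3 → ℝ, IsTest θ ∧ (∀ x, 0 ≤ θ x) ∧ (∀ x, θ x ≤ 1) ∧ (∀ x, ‖x‖ ≤ r → θ x = 1) ∧
      ∀ x, R ≤ ‖x‖ → θ x = 0 := by
  let θ : ContDiffBump (0 : E3) := ⟨r, R, hr, hR⟩
  refine ⟨θ, ⟨θ.contDiff, θ.hasCompactSupport⟩, fun x => θ.nonneg, fun x => θ.le_one,
    fun x hx => θ.one_of_mem_closedBall (by simpa using hx), fun x hx => ?_⟩
  exact θ.zero_of_le_dist (by simpa using hx)

/-- Functions of `(s, x)` that are jointly smooth. -/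
abbrev JointSmooth (a : ℝ → E3 → ℝ) : Prop :=
  ContDiff ℝ ((⊤ : ℕ∞) : WithTop ℕ∞) fun q : ℝ × E3 => a q.1 q.2

theorem JointSmooth.smooth (ha : JointSmooth a) (s : ℝ) : Smooth (a s) :=
  ContDiff.comp (f := fun x : E3 => (s, x)) ha (contDiff_const.prodMk contDiff_id)

theorem Smooth.joint (hf : Smooth f) : JointSmooth fun _ x => f x :=
  ContDiff.comp hf contDiff_snd

protected theorem JointSmooth.mul (ha : JointSmooth a) (hc : JointSmooth c) :
    JointSmooth fun s x => a s x * c s x := ContDiff.mul ha hc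

protected theorem JointSmooth.pd (ha : JointSmooth a) (i : Fin 3) :
    JointSmooth fun s => pd i (a s) := by
  have h : ∀ q : ℝ × E3, pd i (a q.1) q.2
      = fderiv ℝ (fun q : ℝ × E3 => a q.1 q.2) q (0, bv i) := by
    rintro ⟨s, x⟩
    have h1 : HasFDerivAt (fun q : ℝ × E3 => a q.1 q.2) _ (s, x) :=
      (ha.differentiable (by simp) (s, x)).hasFDerivAt
    have h2 := h1.comp x (hasFDerivAt_prodMk_right s x)
    have h3 : fderiv ℝ (a s) x = _ := h2.fderiv
    rw [pd, h3]
    simp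
  have h2 : ContDiff ℝ ((⊤ : ℕ∞) : WithTop ℕ∞) fun q : ℝ × E3 =>
      fderiv ℝ (fun q : ℝ × E3 => a q.1 q.2) q (0, bv i) :=
    (ha.fderiv_right (m := ((⊤ : ℕ∞) : WithTop ℕ∞)) (by norm_cast)).clm_apply contDiff_const
  simpa only [JointSmooth, h] using h2

protected theorem JointSmooth.sum {A : Fin 3 → ℝ → E3 → ℝ} (h : ∀ k, JointSmooth (A k)) :
    JointSmooth fun s x => ∑ k, A k s x := ContDiff.sum fun k _ => h k

protected theorem JointSmooth.lapl (ha : JointSmooth a) : JointSmooth fun s => lapl (a s) :=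
  JointSmooth.sum fun k => (ha.pd k).pd k

theorem JointSmooth.bounded (ha : JointSmooth a) (r : ℝ) :
    ∃ C, 0 ≤ C ∧ ∀ s ∈ Set.Icc (0 : ℝ) 1, ∀ x, ‖x‖ ≤ r → |a s x| ≤ C := by
  obtain ⟨C, hC⟩ := ((isCompact_Icc (a := (0 : ℝ)) (b := 1)).prod
    (isCompact_closedBall (0 : E3) r)).exists_bound_of_continuousOn
    (ContDiff.continuous ha).continuousOn
  refine ⟨max C 0, le_max_right _ _, fun s hs x hx => (le_max_left _ _).trans' ?_⟩
  exact hC (s, x) ⟨hs, by simpa using hx⟩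

/-- Away from the origin the heat kernel is smooth up to time zero. -/
theorem exists_heat_kernel : ∃ k : ℝ → E3 → ℝ, JointSmooth k ∧
    ∀ h : E3 → ℝ, (∀ y, ‖y‖ < 1 / 50 → h y = 0) → ∀ s, 0 < s →
      2 * s * ev (1 / 4) s h 0 = ∫ y, k s y * h y := by
  obtain ⟨θ, hθ, hθ0, hθ1, hθin, hθout⟩ := exists_cutoff (r := 1 / 100) (R := 1 / 50)
    (by norm_num) (by norm_num)
  set n : E3 → ℝ := fun y => ‖y‖ ^ 2 + θ y with hn
  have npos : ∀ y, 0 < n y := by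
    intro y
    rcases eq_or_ne y 0 with rfl | hy
    · simp [hn, hθin]
    · have := norm_pos_iff.2 hy
      have := hθ0 y
      positivity
  have nsm : Smooth n := (contDiff_norm_sq ℝ).add hθ.smooth
  set Ψ : ℝ → ℝ := fun ρ => ρ⁻¹ * expNegInvGlue ρ with hΨ
  have Ψsm : ContDiff ℝ ((⊤ : ℕ∞) : WithTop ℕ∞) Ψ := by
    have := expNegInvGlue.contDiff_polynomial_eval_inv_mul (n := ⊤) (Polynomial.X)
    simpa using this
  set c0 : ℝ := (1 / 4 / Real.pi) ^ (3 / 2 : ℝ) with hc0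
  refine ⟨fun s y => 2 * c0 * (4 * (n y)⁻¹) * Ψ (4 * s ^ 2 * (n y)⁻¹), ?_, ?_⟩
  · have hinv : ContDiff ℝ ((⊤ : ℕ∞) : WithTop ℕ∞) fun q : ℝ × E3 => (n q.2)⁻¹ :=
      (nsm.comp contDiff_snd).inv fun q => (npos q.2).ne'
    exact (contDiff_const.mul (contDiff_const.mul hinv)).mul
      (Ψsm.comp ((contDiff_const.mul (contDiff_fst.pow 2)).mul hinv))
  · intro h hh s hs
    have hs' := hs.ne'
    have e1 : ∀ z, gk (1 / 4) z * h (0 + s • z)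
        = (fun y => gk (1 / 4) (s⁻¹ • y) * h y) (s • z) := by
      intro z
      simp [smul_smul, hs']
    rw [ev]
    simp_rw [e1]
    rw [Measure.integral_comp_smul volume (fun y => gk (1 / 4) (s⁻¹ • y) * h y) s, smul_eq_mul,
      ← integral_const_mul, ← integral_const_mul]
    refine integral_congr_ae (ae_of_all _ fun y => ?_)
    simp only
    rcases lt_or_ge ‖y‖ (1 / 50) with hy | hy
    · simp [hh y hy]
    · have hny : n y = ‖y‖ ^ 2 := by simp [hn, hθout y hy]
      have hy0 : 0 < ‖y‖ := by linarith
      have hρ : 0 < 4 * s ^ 2 * (‖y‖ ^ 2)⁻¹ := by positivity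
      have hexp : -(4 * s ^ 2 * (‖y‖ ^ 2)⁻¹)⁻¹ = -(1 / 4) * ‖s⁻¹ • y‖ ^ 2 := by
        rw [norm_smul, norm_inv, Real.norm_of_nonneg hs.le]
        field_simp
      simp only [hΨ, hny, expNegInvGlue, not_le.2 hρ, if_false, hexp, gk, ← hc0]
      rw [abs_of_pos (by positivity)]
      simp only [finrank_euclideanSpace, Fintype.card_fin]
      field_simp

end Caccioppoli

namespace Caccioppoli

variable {f g : E3 → ℝ} {i j : Fin 3} {U : Fin 3 → E3 → ℝ} {p v κ : E3 → ℝ}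

/-- The steady Navier–Stokes system in components, `v` being the length of the velocity. -/
structure NS (U : Fin 3 → E3 → ℝ) (p v : E3 → ℝ) : Prop where
  smooth : ∀ i, Smooth (U i)
  smooth_p : Smooth p
  momentum : ∀ i x, pd i p x = lapl (U i) x - ∑ j, U j x * pd j (U i) x
  div : ∀ x, ∑ i, pd i (U i) x = 0
  cont_v : Continuous v
  nonneg_v : ∀ x, 0 ≤ v x
  sq_v : ∀ x, v x ^ 2 = ∑ i, U i x ^ 2

namespace NS

theorem abs_comp_le (h : NS U p v) (i : Fin 3) (x : E3) : |U i x| ≤ v x := by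
  refine abs_le_of_sq_le_sq ?_ (h.nonneg_v x)
  rw [h.sq_v]
  exact Finset.single_le_sum (f := fun i => U i x ^ 2) (fun k _ => sq_nonneg _) (Finset.mem_univ i)

theorem smooth_mul (h : NS U p v) (i j : Fin 3) : Smooth fun x => U i x * U j x :=
  (h.smooth i).mul (h.smooth j)

theorem abs_mul_le (h : NS U p v) (i j : Fin 3) (x : E3) : |U i x * U j x| ≤ v x ^ 2 := by
  rw [abs_mul, sq]
  exact mul_le_mul (h.abs_comp_le i x) (h.abs_comp_le j x) (abs_nonneg _) (h.nonneg_v x)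

theorem momentum_div (h : NS U p v) (i : Fin 3) (x : E3) :
    pd i p x = lapl (U i) x - ∑ j, pd j (fun y => U i y * U j y) x := by
  rw [h.momentum]
  congr 1
  simp_rw [pd_mul (h.smooth i) (h.smooth _)]
  rw [Finset.sum_add_distrib, ← Finset.mul_sum, h.div, mul_zero, zero_add]
  exact Finset.sum_congr rfl fun j _ => mul_comm _ _

theorem lapl_p (h : NS U p v) (x : E3) :
    lapl p x = - ∑ i, ∑ j, pd i (pd j fun y => U i y * U j y) x := by
  have e1 : ∀ i, pd i p = fun y => lapl (U i) y + (-1) * ∑ j, pd j (fun y => U i y * U j y) y :=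
    fun i => funext fun y => by rw [h.momentum_div]; ring
  have s1 : ∀ i, Smooth fun y => ∑ j, pd j (fun y => U i y * U j y) y :=
    fun i => ContDiff.sum fun j _ => (h.smooth_mul i j).pd j
  have s2 : ∀ i, Smooth fun y => (-1) * ∑ j, pd j (fun y => U i y * U j y) y :=
    fun i => contDiff_const.mul (s1 i)
  have e2 : ∀ i, pd i (pd i p) x
      = pd i (lapl (U i)) x - ∑ j, pd i (pd j fun y => U i y * U j y) x := by
    intro i
    rw [e1 i, pd_add (h.smooth i).lapl (s2 i), pd_const_mul _ (s1 i),
      pd_sum _ fun j _ => (h.smooth_mul i j).pd j]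
    ring
  have e3 : ∑ i, pd i (lapl (U i)) x = 0 := by
    have a1 : ∀ i, pd i (lapl (U i)) x = ∑ k, pd k (pd k (pd i (U i))) x := by
      intro i
      change pd i (fun y => ∑ k, pd k (pd k (U i)) y) x = _
      rw [pd_sum _ fun k _ => ((h.smooth i).pd k).pd k]
      refine Finset.sum_congr rfl fun k _ => ?_
      rw [pd_comm ((h.smooth i).pd k),
        show pd i (pd k (U i)) = pd k (pd i (U i)) from funext fun y => pd_comm (h.smooth i) y]
    simp_rw [a1]
    rw [Finset.sum_comm]
    refine Finset.sum_eq_zero fun k _ => ?_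
    rw [← pd_sum _ fun i _ => ((h.smooth i).pd i).pd k]
    have : (fun y => ∑ i, pd k (pd i (U i)) y) = fun _ => 0 := by
      funext y
      rw [← pd_sum _ fun i _ => (h.smooth i).pd i]
      rw [show (fun y => ∑ i, pd i (U i) y) = fun _ => 0 from funext h.div]
      simp [pd]
    rw [this]
    simp [pd]
  rw [show lapl p x = ∑ i, pd i (pd i p) x from rfl]
  simp_rw [e2]
  rw [Finset.sum_sub_distrib, e3, zero_sub]

theorem integral_pd_p_mul (h : NS U p v) {ζ : E3 → ℝ} (hζ : IsTest ζ) (i : Fin 3) :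
    ∫ x, pd i p x * ζ x
      = (∫ x, U i x * lapl ζ x) + ∑ j, ∫ x, U i x * U j x * pd j ζ x := by
  have e1 : ∀ x, pd i p x * ζ x = (∑ k, pd k (pd k (U i)) x * ζ x)
      - ∑ j, pd j (fun y => U i y * U j y) x * ζ x := by
    intro x
    rw [h.momentum_div, sub_mul, lapl, Finset.sum_mul, Finset.sum_mul]
  simp_rw [e1]
  have i1 : ∀ k, Integrable fun x => pd k (pd k (U i)) x * ζ x := fun k =>
    ((((h.smooth i).pd k).pd k).mul_test hζ).integrable
  have i2 : ∀ j, Integrable fun x => pd j (fun y => U i y * U j y) x * ζ x := fun j =>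
    (((h.smooth_mul i j).pd j).mul_test hζ).integrable
  have i3 : ∀ k, Integrable fun x => U i x * pd k (pd k ζ) x := fun k =>
    ((h.smooth i).mul_test ((hζ.pd k).pd k)).integrable
  rw [integral_sub (integrable_finsetSum _ fun k _ => i1 k)
    (integrable_finsetSum _ fun k _ => i2 k), integral_finsetSum _ fun k _ => i1 k,
    integral_finsetSum _ fun k _ => i2 k]
  simp only [lapl, Finset.mul_sum]
  rw [integral_finsetSum _ fun k _ => i3 k, sub_eq_add_neg, ← Finset.sum_neg_distrib]
  congr 1
  · refine Finset.sum_congr rfl fun k _ => ?_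
    rw [integral_smooth_mul_pd (h.smooth i) (hζ.pd k), integral_smooth_mul_pd ((h.smooth i).pd k) hζ,
      neg_neg]
  · refine Finset.sum_congr rfl fun j _ => ?_
    rw [integral_smooth_mul_pd (h.smooth_mul i j) hζ]

end NS

/-- The correlation of `p` with a kernel. -/
def corr (p κ : E3 → ℝ) (x : E3) : ℝ := ∫ y, p (x + y) * κ y

theorem corr_eq_convolution (p κ : E3 → ℝ) :
    corr p κ = convolution (fun y => κ (-y)) p (ContinuousLinearMap.mul ℝ ℝ) volume := by
  funext x
  rw [corr, convolution_def, ← integral_neg_eq_self]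
  refine integral_congr_ae (ae_of_all _ fun y => ?_)
  simp [mul_comm, sub_eq_add_neg]

theorem hasFDerivAt_corr (hp : Smooth p) (hκ : IsTest κ) (x : E3) :
    DifferentiableAt ℝ (corr p κ) x ∧
      ∀ i, pd i (corr p κ) x = ∫ y, pd i p y * κ (y - x) := by
  have hκ' : IsTest fun y => κ (-y) := by simpa using hκ.comp_sub_left 0
  have key := hκ'.compact.hasFDerivAt_convolution_left (ContinuousLinearMap.mul ℝ ℝ) (μ := volume)
    (hκ'.smooth.of_le (by norm_cast)) (hp.continuous.locallyIntegrable) x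
  rw [← corr_eq_convolution] at key
  refine ⟨key.differentiableAt, fun i => ?_⟩
  rw [pd, key.fderiv]
  have hex := (hκ'.compact.fderiv (𝕜 := ℝ)).convolutionExists_left
    (L := (ContinuousLinearMap.mul ℝ ℝ).precompL E3) (μ := volume)
    (hκ'.smooth.continuous_fderiv (by simp)) (hp.continuous.locallyIntegrable) x
  rw [convolution_def, ContinuousLinearMap.integral_apply hex]
  have e : ∀ t, ((ContinuousLinearMap.mul ℝ ℝ).precompL E3 (fderiv ℝ (fun y => κ (-y)) t) (p (x - t)))
      (bv i) = p (x - t) * pd i (fun y => κ (-y)) t := fun t => by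
    simp [ContinuousLinearMap.precompL_apply, pd, mul_comm]
  simp_rw [e]
  have e2 : ∀ t, pd i (fun y => κ (-y)) t = - pd i κ (-t) := fun t => by
    have := pd_sub_left (i := i) hκ.smooth 0 t
    simpa using this
  simp_rw [e2]
  rw [← integral_neg_eq_self, ← integral_add_right_eq_self _ (-x)]
  have e3 : ∀ y, p (x - -(y + -x)) * -pd i κ (- -(y + -x)) = -(p y * pd i (fun z => κ (z - x)) y) := by
    intro y
    rw [pd_sub_right]
    simp [sub_eq_add_neg]
  simp_rw [e3]
  rw [integral_neg, integral_smooth_mul_pd hp (hκ.comp_sub_right x), neg_neg]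

end Caccioppoli

namespace Caccioppoli

variable {f g : E3 → ℝ} {i j : Fin 3} {U : Fin 3 → E3 → ℝ} {p v κ : E3 → ℝ}

theorem measurableSet_ann (R : ℝ) : MeasurableSet (ann R) :=
  measurableSet_ball.diff measurableSet_ball

theorem mem_ann {R : ℝ} {x : E3} : x ∈ ann R ↔ ‖x‖ < R ∧ R / 2 ≤ ‖x‖ := by
  simp [ann]

theorem integrableOn_ann (hf : Continuous f) (R : ℝ) : IntegrableOn f (ann R) :=
  (hf.continuousOn.integrableOn_compact (isCompact_closedBall (0 : E3) R)).mono_set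
    (Set.sdiff_subset.trans ball_subset_closedBall)

theorem abs_integral_mul_le {a b w : E3 → ℝ} {A : Set E3} {K : ℝ} (hA : MeasurableSet A)
    (hw : IntegrableOn w A) (hb : ∀ x ∈ A, |b x| ≤ K) (hb0 : ∀ x ∉ A, b x = 0)
    (ha : ∀ x ∈ A, |a x| ≤ w x) : |∫ x, a x * b x| ≤ K * ∫ x in A, w x := by
  rw [← integral_indicator hA, ← integral_const_mul]
  rw [← Real.norm_eq_abs]
  refine norm_integral_le_of_norm_le (((integrable_indicator_iff hA).2 hw).const_mul K)
    (ae_of_all _ fun x => ?_)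
  by_cases hx : x ∈ A
  · rw [Set.indicator_of_mem hx, Real.norm_eq_abs, abs_mul, mul_comm]
    exact mul_le_mul (hb x hx) (ha x hx) (abs_nonneg _) ((abs_nonneg _).trans (hb x hx))
  · simp [hb0 x hx, Set.indicator_of_notMem hx]

theorem pd_eq_zero_of_lt_norm {r : ℝ} (hf : ∀ y, r < ‖y‖ → f y = 0) (y : E3) (hy : r < ‖y‖) :
    pd i f y = 0 := by
  have : f =ᶠ[nhds y] fun _ => 0 :=
    (continuous_norm.continuousAt.eventually_mem (Ioi_mem_nhds hy)).mono fun z hz => hf z hz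
  simp [pd, this.fderiv_eq]

theorem lapl_eq_zero_of_lt_norm {r : ℝ} (hf : ∀ y, r < ‖y‖ → f y = 0) (y : E3) (hy : r < ‖y‖) :
    lapl f y = 0 :=
  Finset.sum_eq_zero fun _ _ => pd_eq_zero_of_lt_norm (pd_eq_zero_of_lt_norm hf) y hy

theorem NS.abs_pd_corr_le (h : NS U p v) (hκ : IsTest κ) {K : ℝ}
    (h0 : ∀ y, 1 / 20 < ‖y‖ → κ y = 0) (h1 : ∀ j y, |pd j κ y| ≤ K) (h2 : ∀ y, |lapl κ y| ≤ K)
    {x : E3} (hx : 56 / 100 ≤ ‖x‖) (hx' : ‖x‖ ≤ 9 / 10) (i : Fin 3) :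
    |pd i (corr p κ) x| ≤ K * ((∫ y in ann 1, v y) + 3 * ∫ y in ann 1, v y ^ 2) := by
  have far : ∀ y, y ∉ ann 1 → 1 / 20 < ‖y - x‖ := by
    intro y hy
    rw [mem_ann] at hy
    by_contra! hc
    have := abs_norm_sub_norm_le y x
    rw [abs_le] at this
    exact hy ⟨by linarith, by linarith⟩
  rw [(hasFDerivAt_corr h.smooth_p hκ x).2 i, h.integral_pd_p_mul (hκ.comp_sub_right x)]
  have e1 : ∀ j y, pd j (fun z => κ (z - x)) y = pd j κ (y - x) := fun j y => pd_sub_right _ _ _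
  have e2 : ∀ y, lapl (fun z => κ (z - x)) y = lapl κ (y - x) := fun y => by
    refine Finset.sum_congr rfl fun k _ => ?_
    rw [show pd k (fun z => κ (z - x)) = fun z => pd k κ (z - x) from funext (e1 k), pd_sub_right]
  simp_rw [e1, e2]
  have b1 : |∫ y, U i y * lapl κ (y - x)| ≤ K * ∫ y in ann 1, v y :=
    abs_integral_mul_le (measurableSet_ann 1) (integrableOn_ann h.cont_v 1) (fun y _ => h2 _)
      (fun y hy => lapl_eq_zero_of_lt_norm h0 _ (far y hy)) fun y _ => h.abs_comp_le i y
  have b2 : ∀ j, |∫ y, U i y * U j y * pd j κ (y - x)| ≤ K * ∫ y in ann 1, v y ^ 2 := fun j =>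
    abs_integral_mul_le (measurableSet_ann 1) (integrableOn_ann (h.cont_v.pow 2) 1)
      (fun y _ => h1 j _) (fun y hy => pd_eq_zero_of_lt_norm h0 _ (far y hy))
      fun y _ => h.abs_mul_le i j y
  refine (abs_add_le _ _).trans ?_
  rw [mul_add]
  refine add_le_add b1 ((Finset.abs_sum_le_sum_abs _ _).trans ?_)
  refine (Finset.sum_le_sum fun j _ => b2 j).trans ?_
  simp
  linarith

theorem norm_fderiv_le {B : ℝ} {x : E3} (hB : ∀ i, |pd i f x| ≤ B) : ‖fderiv ℝ f x‖ ≤ 3 * B := by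
  have hB0 : 0 ≤ B := (abs_nonneg _).trans (hB 0)
  refine ContinuousLinearMap.opNorm_le_bound _ (by positivity) fun z => ?_
  rw [fderiv_eq_sum_pd, Real.norm_eq_abs]
  refine (Finset.abs_sum_le_sum_abs _ _).trans
    ((Finset.sum_le_sum fun i _ => ?_).trans_eq (b := ∑ _i : Fin 3, ‖z‖ * B) (by simp; ring))
  rw [abs_mul]
  exact mul_le_mul (abs_coord_le_norm z i) (hB i) (abs_nonneg _) (norm_nonneg _)

theorem norm_segment_ge {a b z : E3} (ha : 8 / 10 ≤ ‖a‖) (hb : 8 / 10 ≤ ‖b‖)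
    (hab : 0 ≤ inner ℝ a b) (hz : z ∈ segment ℝ a b) : 56 / 100 ≤ ‖z‖ := by
  obtain ⟨s, t, hs, ht, hst, rfl⟩ := hz
  have e : ‖s • a + t • b‖ ^ 2 = s ^ 2 * ‖a‖ ^ 2 + 2 * (s * t) * inner ℝ a b + t ^ 2 * ‖b‖ ^ 2 := by
    rw [norm_add_sq_real, norm_smul, norm_smul, inner_smul_left, inner_smul_right]
    simp only [Real.norm_eq_abs, mul_pow, sq_abs, conj_trivial]
    ring
  have h1 : (8 / 10 : ℝ) ^ 2 ≤ ‖a‖ ^ 2 := by gcongr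
  have h2 : (8 / 10 : ℝ) ^ 2 ≤ ‖b‖ ^ 2 := by gcongr
  have h3 : s ^ 2 * (8 / 10) ^ 2 + t ^ 2 * (8 / 10) ^ 2 ≤ ‖s • a + t • b‖ ^ 2 := by
    rw [e]
    have := mul_le_mul_of_nonneg_left h1 (sq_nonneg s)
    have := mul_le_mul_of_nonneg_left h2 (sq_nonneg t)
    have : 0 ≤ 2 * (s * t) * inner ℝ a b := by positivity
    linarith
  have h4 : t = 1 - s := by linarith
  subst h4
  have h5 : (56 / 100 : ℝ) ^ 2 ≤ ‖s • a + (1 - s) • b‖ ^ 2 := by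
    nlinarith [sq_nonneg (2 * s - 1)]
  exact le_of_sq_le_sq h5 (norm_nonneg _)

theorem abs_sub_le_of_inner_nonneg {B : ℝ} {a b : E3} (hd : Differentiable ℝ f)
    (hB : ∀ x : E3, 56 / 100 ≤ ‖x‖ → ‖x‖ ≤ 9 / 10 → ∀ i, |pd i f x| ≤ B)
    (ha : 8 / 10 ≤ ‖a‖) (ha' : ‖a‖ ≤ 9 / 10) (hb : 8 / 10 ≤ ‖b‖) (hb' : ‖b‖ ≤ 9 / 10)
    (hab : 0 ≤ inner ℝ a b) : |f b - f a| ≤ 6 * B := by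
  have hB0 : 0 ≤ B := (abs_nonneg _).trans (hB a (by linarith) ha' 0)
  have hs : ∀ z ∈ segment ℝ a b, ‖fderiv ℝ f z‖ ≤ 3 * B := by
    intro z hz
    have h1 := norm_segment_ge ha hb hab hz
    have h2 : z ∈ closedBall (0 : E3) (9 / 10) :=
      (convex_closedBall (0 : E3) (9 / 10)).segment_subset (by simpa using ha') (by simpa using hb') hz
    exact norm_fderiv_le (hB z h1 (by simpa using h2))
  have h1 := (convex_segment (𝕜 := ℝ) a b).norm_image_sub_le_of_norm_fderiv_le
    (fun z _ => hd z) hs (left_mem_segment ℝ a b) (right_mem_segment ℝ a b)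
  have h2 : ‖b - a‖ ≤ 2 := (norm_sub_le _ _).trans (by linarith)
  rw [Real.norm_eq_abs] at h1
  nlinarith

/-- Base point used to normalise the pressure. -/
def basePt : E3 := (8 / 10 : ℝ) • bv 0

theorem abs_sub_basePt_le {B : ℝ} (hd : Differentiable ℝ f)
    (hB : ∀ x : E3, 56 / 100 ≤ ‖x‖ → ‖x‖ ≤ 9 / 10 → ∀ i, |pd i f x| ≤ B) {x : E3}
    (hx : 8 / 10 ≤ ‖x‖) (hx' : ‖x‖ ≤ 9 / 10) : |f x - f basePt| ≤ 12 * B := by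
  have n0 : ‖basePt‖ = 8 / 10 := by simp [basePt, norm_smul, bv]
  obtain ⟨y, hy, hxy, hy0⟩ : ∃ y : E3, ‖y‖ = 8 / 10 ∧ 0 ≤ inner ℝ x y ∧ inner ℝ y basePt = 0 := by
    rcases le_total 0 (inner ℝ x (bv 1)) with hi | hi
    · refine ⟨(8 / 10 : ℝ) • bv 1, by simp [norm_smul, bv], ?_, by simp [basePt, bv, inner_smul_left, inner_smul_right, EuclideanSpace.inner_single_left]⟩
      rw [inner_smul_right]
      positivity
    · refine ⟨(-(8 / 10) : ℝ) • bv 1, by simp [norm_smul, bv], ?_, by simp [basePt, bv, inner_smul_left, inner_smul_right, EuclideanSpace.inner_single_left]⟩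
      rw [inner_smul_right]
      nlinarith
  have h1 := abs_sub_le_of_inner_nonneg hd hB hx hx' hy.ge (by rw [hy]; norm_num) hxy
  have h2 := abs_sub_le_of_inner_nonneg hd hB hy.ge (by rw [hy]; norm_num) n0.ge
    (by rw [n0]; norm_num) hy0.ge
  rw [abs_le] at *
  constructor <;> linarith [h1.1, h1.2, h2.1, h2.2]

theorem NS.abs_corr_sub_le (h : NS U p v) (hκ : IsTest κ) {K : ℝ}
    (h0 : ∀ y, 1 / 20 < ‖y‖ → κ y = 0) (h1 : ∀ j y, |pd j κ y| ≤ K) (h2 : ∀ y, |lapl κ y| ≤ K)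
    {x : E3} (hx : 8 / 10 ≤ ‖x‖) (hx' : ‖x‖ ≤ 9 / 10) :
    |corr p κ x - corr p κ basePt| ≤
      12 * (K * ((∫ y in ann 1, v y) + 3 * ∫ y in ann 1, v y ^ 2)) :=
  abs_sub_basePt_le (fun z => (hasFDerivAt_corr h.smooth_p hκ z).1)
    (fun _ hz hz' i => h.abs_pd_corr_le hκ h0 h1 h2 hz hz' i) hx hx'

end Caccioppoli

namespace Caccioppoli

variable {f g : E3 → ℝ} {i j : Fin 3} {U : Fin 3 → E3 → ℝ} {p v κ θ χ : E3 → ℝ}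
  {k : ℝ → E3 → ℝ}

theorem quarter_pos' : (0 : ℝ) < 1 / 4 := by norm_num

theorem lapl_mul (hf : Smooth f) (hg : Smooth g) (x : E3) :
    lapl (fun y => f y * g y) x
      = f x * lapl g x + (lapl f x * g x + 2 * ∑ l, pd l f x * pd l g x) := by
  have e : ∀ l, pd l (pd l fun y => f y * g y) x
      = f x * pd l (pd l g) x + (pd l (pd l f) x * g x + 2 * (pd l f x * pd l g x)) := by
    intro l
    rw [show pd l (fun y => f y * g y) = fun y => f y * pd l g y + pd l f y * g y from
      funext (pd_mul hf hg), pd_add (hf.mul (hg.pd l)) ((hf.pd l).mul hg), pd_mul hf (hg.pd l),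
      pd_mul (hf.pd l) hg]
    ring
  simp only [lapl, e, Finset.sum_add_distrib, Finset.mul_sum, Finset.sum_mul]

theorem pd_add_left (f : E3 → ℝ) (a x : E3) : pd i (fun y => f (a + y)) x = pd i f (a + x) := by
  have := pd_sub_right (i := i) f (-a) x
  simpa only [sub_neg_eq_add, add_comm] using this

theorem pd_add_left' (f : E3 → ℝ) (a : E3) :
    pd i (fun y => f (a + y)) = fun y => pd i f (a + y) := funext (pd_add_left f a)

theorem lapl_add_left (f : E3 → ℝ) (a x : E3) : lapl (fun y => f (a + y)) x = lapl f (a + x) := by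
  simp only [lapl, pd_add_left']

theorem Smooth.comp_add_left (hf : Smooth f) (a : E3) : Smooth fun y => f (a + y) :=
  ContDiff.comp hf (contDiff_const.add contDiff_id)

theorem IsTest.continuous_mul_ev (hf : IsTest f) (x : E3) :
    Continuous fun s : ℝ => 2 * s * ev (1 / 4) s f x :=
  (by fun_prop : Continuous fun s : ℝ => 2 * s).mul
    ((hf.continuous_ev quarter_pos').comp (by fun_prop : Continuous fun s : ℝ => (s, x)))

/-- Representation of a test function by its heat flow. -/
theorem IsTest.eq_ev_sub (hf : IsTest f) (x : E3) :
    f x = ev (1 / 4) 1 f x - ∫ s in (0 : ℝ)..1, 2 * s * ev (1 / 4) s (lapl f) x := by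
  have h := intervalIntegral.integral_eq_sub_of_hasDerivAt (a := 0) (b := 1)
    (f := fun t => ev (1 / 4) t f x) (f' := fun s => 2 * s * ev (1 / 4) s (lapl f) x)
    (fun s _ => by
      simpa only [show s / (2 * (1 / 4)) = 2 * s by ring] using hf.hasDerivAt_ev quarter_pos' s x)
    ((hf.lapl.continuous_mul_ev x).intervalIntegrable _ _)
  rw [h, ev_zero quarter_pos']
  ring

theorem IsTest.ev_add (hf : IsTest f) (hg : IsTest g) (s : ℝ) (x : E3) :
    ev (1 / 4) s (fun y => f y + g y) x = ev (1 / 4) s f x + ev (1 / 4) s g x := by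
  simp only [ev, mul_add]
  exact integral_add (hf.integrable_gk_mul quarter_pos' s x) (hg.integrable_gk_mul quarter_pos' s x)

/-- The commutator terms in the Laplacian of a localised translate of `p`. -/
def commutator (p θ : E3 → ℝ) (x y : E3) : ℝ :=
  lapl θ y * p (x + y) + 2 * ∑ l, pd l θ y * pd l p (x + y)

theorem isTest_commutator (hp : Smooth p) (hθ : IsTest θ) (x : E3) :
    IsTest (commutator p θ x) :=
  (hθ.lapl.mul_smooth (hp.comp_add_left x)).add ((IsTest.sum _ fun l _ =>
    (hθ.pd l).mul_smooth ((hp.pd l).comp_add_left x)).const_mul 2)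

theorem eq_corr_sub (hp : Smooth p) (hθ : IsTest θ) (hθ0 : θ 0 = 1) (x : E3) :
    p x = corr p (fun y => θ y * gk (1 / 4) y) x
      - (∫ s in (0 : ℝ)..1, 2 * s * ev (1 / 4) s (fun y => θ y * lapl p (x + y)) 0)
      - ∫ s in (0 : ℝ)..1, 2 * s * ev (1 / 4) s (commutator p θ x) 0 := by
  have hA : IsTest fun y => θ y * p (x + y) := hθ.mul_smooth (hp.comp_add_left x)
  have h1 : IsTest fun y => θ y * lapl p (x + y) := hθ.mul_smooth (hp.lapl.comp_add_left x)
  have h2 := isTest_commutator hp hθ x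
  have e := hA.eq_ev_sub 0
  have e1 : lapl (fun y => θ y * p (x + y))
      = fun y => θ y * lapl p (x + y) + commutator p θ x y := by
    funext y
    rw [lapl_mul hθ.smooth (hp.comp_add_left x), lapl_add_left]
    simp only [commutator, pd_add_left]
  simp only [e1, h1.ev_add h2, mul_add, hθ0, one_mul, add_zero] at e
  rw [intervalIntegral.integral_add ((h1.continuous_mul_ev 0).intervalIntegrable _ _)
    ((h2.continuous_mul_ev 0).intervalIntegrable _ _)] at e
  rw [e, sub_sub]
  congr 1
  simp only [ev, corr, one_smul, zero_add]
  refine integral_congr_ae (ae_of_all _ fun y => ?_)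
  ring

/-- The kernel obtained from `commutator` after integrating by parts against `k`. -/
def commKernel (k : ℝ → E3 → ℝ) (θ : E3 → ℝ) (s : ℝ) (y : E3) : ℝ :=
  k s y * lapl θ y + (-2) * ∑ l, pd l (fun y => k s y * pd l θ y) y

theorem jointSmooth_commKernel (hk : JointSmooth k) (hθ : IsTest θ) :
    JointSmooth (commKernel k θ) := by
  have h1 := hk.mul hθ.lapl.smooth.joint
  have h2 : JointSmooth fun s y => (-2) * ∑ l, pd l (fun y => k s y * pd l θ y) y :=
    JointSmooth.mul (a := fun _ _ => -2) contDiff_const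
      (JointSmooth.sum fun l => (hk.mul (hθ.pd l).smooth.joint).pd l)
  exact ContDiff.add h1 h2

theorem commKernel_eq_zero {r : ℝ} (hθ : ∀ y, r < ‖y‖ → θ y = 0) (s : ℝ) (y : E3) (hy : r < ‖y‖) :
    commKernel k θ s y = 0 := by
  have h : ∀ l, pd l (fun y => k s y * pd l θ y) y = 0 := fun l =>
    pd_eq_zero_of_lt_norm (fun z hz => by rw [pd_eq_zero_of_lt_norm hθ z hz, mul_zero]) y hy
  simp [commKernel, h, lapl_eq_zero_of_lt_norm hθ y hy]

theorem isTest_of_eq_zero {r : ℝ} (hf : Smooth f) (h : ∀ y, r < ‖y‖ → f y = 0) : IsTest f :=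
  ⟨hf, HasCompactSupport.intro (isCompact_closedBall (0 : E3) r) fun y hy =>
    h y (by simpa using hy)⟩

theorem JointSmooth.bounded_pd_lapl (hk : JointSmooth k) {r : ℝ}
    (h0 : ∀ s y, r < ‖y‖ → k s y = 0) :
    ∃ K, 0 ≤ K ∧ ∀ s ∈ Set.Icc (0 : ℝ) 1, (∀ j y, |pd j (k s) y| ≤ K) ∧ ∀ y, |lapl (k s) y| ≤ K := by
  choose D hD0 hD using fun j => (hk.pd j).bounded r
  obtain ⟨L, hL0, hL⟩ := hk.lapl.bounded r
  have hDs : 0 ≤ ∑ j, D j := Finset.sum_nonneg fun j _ => hD0 j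
  refine ⟨∑ j, D j + L, by positivity, fun s hs => ⟨fun j y => ?_, fun y => ?_⟩⟩
  · have := Finset.single_le_sum (fun j _ => hD0 j) (Finset.mem_univ j)
    rcases le_or_gt ‖y‖ r with hy | hy
    · linarith [hD j s hs y hy]
    · rw [pd_eq_zero_of_lt_norm (h0 s) y hy, abs_zero]; positivity
  · rcases le_or_gt ‖y‖ r with hy | hy
    · linarith [hL s hs y hy]
    · rw [lapl_eq_zero_of_lt_norm (h0 s) y hy, abs_zero]; positivity

theorem integral_mul_commutator (hk : JointSmooth k) (hp : Smooth p) (hθ : IsTest θ) (s : ℝ)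
    (x : E3) : ∫ y, k s y * commutator p θ x y = corr p (commKernel k θ s) x := by
  have hks := hk.smooth s
  have hpx := hp.comp_add_left x
  have t1 : IsTest fun y => k s y * lapl θ y := hks.mul_test hθ.lapl
  have t2 : ∀ l, IsTest fun y => k s y * pd l θ y := fun l => hks.mul_test (hθ.pd l)
  have i1 := (t1.mul_smooth hpx).integrable
  have i2 : ∀ l, Integrable fun y => k s y * pd l θ y * pd l p (x + y) := fun l =>
    ((t2 l).mul_smooth ((hp.pd l).comp_add_left x)).integrable
  have i3 : ∀ l, Integrable fun y => pd l (fun y => k s y * pd l θ y) y * p (x + y) := fun l =>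
    (((t2 l).pd l).mul_smooth hpx).integrable
  have e1 : ∀ y, k s y * commutator p θ x y = k s y * lapl θ y * p (x + y)
      + 2 * ∑ l, k s y * pd l θ y * pd l p (x + y) := fun y => by
    simp only [commutator, mul_add, Finset.mul_sum]
    congr 1
    · ring
    · exact Finset.sum_congr rfl fun l _ => by ring
  have e2 : ∀ y, p (x + y) * commKernel k θ s y = k s y * lapl θ y * p (x + y)
      + (-2) * ∑ l, pd l (fun y => k s y * pd l θ y) y * p (x + y) := fun y => by
    rw [commKernel, ← Finset.sum_mul]
    ring
  have e3 : ∀ l, ∫ y, k s y * pd l θ y * pd l p (x + y)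
      = - ∫ y, pd l (fun y => k s y * pd l θ y) y * p (x + y) := fun l => by
    rw [← integral_test_mul_pd (t2 l) hpx, pd_add_left']
  simp only [corr, e1, e2]
  rw [integral_add i1 ((integrable_finsetSum _ fun l _ => i2 l).const_mul _),
    integral_add i1 ((integrable_finsetSum _ fun l _ => i3 l).const_mul _),
    integral_const_mul, integral_const_mul, integral_finsetSum _ fun l _ => i2 l,
    integral_finsetSum _ fun l _ => i3 l, Finset.sum_congr rfl fun l _ => e3 l,
    Finset.sum_neg_distrib]
  ring

/-- Cutoff functions of the unit annulus. -/
structure Cut (χ : E3 → ℝ) : Prop where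
  test : IsTest χ
  nonneg : ∀ x, 0 ≤ χ x
  le_one : ∀ x, χ x ≤ 1
  eq_one : ∀ x : E3, 3 / 4 ≤ ‖x‖ → ‖x‖ ≤ 95 / 100 → χ x = 1
  eq_zero : ∀ x, x ∉ ann 1 → χ x = 0

theorem exists_cut : ∃ χ, Cut χ := by
  obtain ⟨a, ha, ha0, ha1, hain, haout⟩ := exists_cutoff (r := 95 / 100) (R := 1)
    (by norm_num) (by norm_num)
  obtain ⟨c, hc, hc0, hc1, hcin, hcout⟩ := exists_cutoff (r := 1 / 2) (R := 3 / 4)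
    (by norm_num) (by norm_num)
  refine ⟨fun x => a x * (1 - c x), ha.mul_smooth (contDiff_const.sub hc.smooth),
    fun x => mul_nonneg (ha0 x) (by linarith [hc1 x]),
    fun x => mul_le_one₀ (ha1 x) (by linarith [hc1 x]) (by linarith [hc0 x]),
    fun x h1 h2 => by rw [hain x h2, hcout x h1]; norm_num, fun x hx => ?_⟩
  rw [mem_ann, not_and_or, not_lt, not_le] at hx
  rcases hx with hx | hx
  · rw [haout x hx, zero_mul]
  · rw [hcin x hx.le]; ring

/-- The localised quadratic source of the pressure. -/
def quad (U : Fin 3 → E3 → ℝ) (χ : E3 → ℝ) (x : E3) : ℝ :=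
  ∑ i, ∑ j, pd i (pd j fun y => χ y * (U i y * U j y)) x

theorem NS.isTest_cut_mul (h : NS U p v) (hχ : Cut χ) (i j : Fin 3) :
    IsTest fun y => χ y * (U i y * U j y) := hχ.test.mul_smooth (h.smooth_mul i j)

theorem NS.isTest_quad (h : NS U p v) (hχ : Cut χ) : IsTest (quad U χ) :=
  IsTest.sum _ fun i _ => IsTest.sum _ fun j _ => ((h.isTest_cut_mul hχ i j).pd j).pd i

theorem pd_eventuallyEq {x : E3} (hfg : f =ᶠ[nhds x] g) : pd i f =ᶠ[nhds x] pd i g :=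
  (hfg.fderiv (𝕜 := ℝ)).mono fun y hy => by simp only [pd]; rw [hy]

theorem NS.lapl_p_eq_quad (h : NS U p v) (hχ : Cut χ) {x : E3} (hx : 3 / 4 < ‖x‖)
    (hx' : ‖x‖ < 95 / 100) : lapl p x = - quad U χ x := by
  rw [h.lapl_p, quad]
  congr 1
  refine Finset.sum_congr rfl fun i _ => Finset.sum_congr rfl fun j _ => ?_
  refine (pd_eventuallyEq (pd_eventuallyEq ?_)).eq_of_nhds
  filter_upwards [continuous_norm.continuousAt.eventually_mem (Ioo_mem_nhds hx hx')] with y hy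
  rw [hχ.eq_one y hy.1.le hy.2.le, one_mul]

theorem IsTest.comp_add_left (hg : IsTest g) (x : E3) : IsTest fun y => g (x + y) := by
  simpa [add_comm] using hg.comp_sub_right (-x)

theorem integral_mul_pd_pd (hf : Smooth f) (hg : IsTest g) (x : E3) :
    ∫ y, f y * pd i (pd j g) (x + y) = ∫ y, pd j (pd i f) y * g (x + y) := by
  have h1 := integral_smooth_mul_pd hf ((hg.pd j).comp_add_left x) i
  have h2 := integral_smooth_mul_pd (hf.pd i) (hg.comp_add_left x) j
  simp only [pd_add_left] at h1 h2
  rw [h1, h2, neg_neg]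

theorem NS.integral_mul_quad (h : NS U p v) (hχ : Cut χ) {c : E3 → ℝ} (hc : Smooth c) (x : E3) :
    ∫ y, c y * quad U χ (x + y)
      = ∑ i, ∑ j, ∫ y, U i y * U j y * (χ y * pd j (pd i c) (y - x)) := by
  have t := fun i j => (h.isTest_cut_mul hχ i j)
  have i1 : ∀ i j, Integrable fun y => c y * pd i (pd j fun y => χ y * (U i y * U j y)) (x + y) :=
    fun i j => (hc.mul_test ((((t i j).pd j).pd i).comp_add_left x)).integrable
  simp only [quad, Finset.mul_sum]
  rw [integral_finsetSum _ fun i _ => integrable_finsetSum _ fun j _ => i1 i j]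
  refine Finset.sum_congr rfl fun i _ => ?_
  rw [integral_finsetSum _ fun j _ => i1 i j]
  refine Finset.sum_congr rfl fun j _ => ?_
  rw [integral_mul_pd_pd hc (t i j),
    ← integral_add_left_eq_self (fun y => U i y * U j y * (χ y * pd j (pd i c) (y - x))) x]
  refine integral_congr_ae (ae_of_all _ fun y => ?_)
  simp only [add_sub_cancel_left]
  ring

end Caccioppoli

namespace Caccioppoli

variable {f g : E3 → ℝ} {i j : Fin 3} {U : Fin 3 → E3 → ℝ} {p v κ θ χ : E3 → ℝ}
  {k : ℝ → E3 → ℝ}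

theorem NS.integral_ev_cut (h : NS U p v) (hχ : Cut χ) (hθ : IsTest θ)
    (hθ0 : ∀ y, 1 / 20 ≤ ‖y‖ → θ y = 0) {x : E3} (hx : 8 / 10 ≤ ‖x‖) (hx' : ‖x‖ ≤ 9 / 10) :
    ∫ s in (0 : ℝ)..1, 2 * s * ev (1 / 4) s (fun y => θ y * lapl p (x + y)) 0
      = (∫ s in (0 : ℝ)..1, 2 * s * ev (1 / 4) s (fun y => (1 - θ y) * quad U χ (x + y)) 0)
        - ∫ s in (0 : ℝ)..1, 2 * s * ev (1 / 4) s (quad U χ) x := by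
  have hq := h.isTest_quad hχ
  have hqx := hq.comp_add_left x
  have hm : IsTest fun y => (1 - θ y) * quad U χ (x + y) :=
    Smooth.mul_test (contDiff_const.sub hθ.smooth) hqx
  have hl : IsTest fun y => θ y * lapl p (x + y) := hθ.mul_smooth (h.smooth_p.lapl.comp_add_left x)
  rw [← intervalIntegral.integral_sub ((hm.continuous_mul_ev 0).intervalIntegrable _ _)
    ((hq.continuous_mul_ev x).intervalIntegrable _ _)]
  congr 1
  funext s
  have e1 : (fun y => (1 - θ y) * quad U χ (x + y))
      = fun y => θ y * lapl p (x + y) + quad U χ (x + y) := by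
    funext y
    by_cases hy : 1 / 20 ≤ ‖y‖
    · rw [hθ0 y hy]; ring
    · have h1 := norm_add_le x y
      have h2 := norm_sub_norm_le x (-y)
      rw [norm_neg, sub_neg_eq_add] at h2
      rw [h.lapl_p_eq_quad hχ (by linarith) (by linarith)]
      ring
  rw [e1, hl.ev_add hqx, show ev (1 / 4) s (fun y => quad U χ (x + y)) 0 = ev (1 / 4) s (quad U χ) x by
    simp [ev]]
  ring

theorem JointSmooth.exists_quad_bound {c : ℝ → E3 → ℝ} (hc : JointSmooth c) :
    ∃ K, 0 ≤ K ∧ ∀ (U : Fin 3 → E3 → ℝ) (p v χ : E3 → ℝ), NS U p v → Cut χ →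
      ∀ s ∈ Set.Icc (0 : ℝ) 1, ∀ x : E3, ‖x‖ ≤ 1 →
        |∫ y, c s y * quad U χ (x + y)| ≤ K * ∫ y in ann 1, v y ^ 2 := by
  choose D hD0 hD using fun i j => ((hc.pd i).pd j).bounded 2
  refine ⟨∑ i, ∑ j, D i j, Finset.sum_nonneg fun i _ => Finset.sum_nonneg fun j _ => hD0 i j,
    fun U p v χ h hχ s hs x hx => ?_⟩
  rw [h.integral_mul_quad hχ (hc.smooth s)]
  simp only [Finset.sum_mul]
  refine (Finset.abs_sum_le_sum_abs _ _).trans (Finset.sum_le_sum fun i _ => ?_)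
  refine (Finset.abs_sum_le_sum_abs _ _).trans (Finset.sum_le_sum fun j _ => ?_)
  refine abs_integral_mul_le (measurableSet_ann 1) (integrableOn_ann (h.cont_v.pow 2) 1)
    (fun y hy => ?_) (fun y hy => by rw [hχ.eq_zero y hy, zero_mul]) fun y _ => h.abs_mul_le i j y
  rw [abs_mul, abs_of_nonneg (hχ.nonneg y)]
  have h1 : ‖y - x‖ ≤ 2 := (norm_sub_le _ _).trans (by linarith [(mem_ann.1 hy).1])
  exact (mul_le_of_le_one_left (abs_nonneg _) (hχ.le_one y)).trans (hD i j s hs _ h1)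

theorem abs_intervalIntegral_le {F : ℝ → ℝ} {C : ℝ} (h : ∀ s, 0 < s → s ≤ 1 → |F s| ≤ C) :
    |∫ s in (0 : ℝ)..1, F s| ≤ C := by
  have := intervalIntegral.norm_integral_le_of_norm_le_const (a := 0) (b := 1) (f := F) (C := C)
    fun s hs => by
      rw [Set.uIoc_of_le zero_le_one] at hs
      exact h s hs.1 hs.2
  simpa using this

/-- On the middle shell the pressure is a heat flow of the local quadratic source, up to
a constant and a controlled error. -/
theorem exists_pressure_bound : ∃ C, 0 ≤ C ∧ ∀ (U : Fin 3 → E3 → ℝ) (p v χ : E3 → ℝ),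
    NS U p v → Cut χ → ∃ c : ℝ, ∀ x : E3, 8 / 10 ≤ ‖x‖ → ‖x‖ ≤ 9 / 10 →
      |p x - (∫ s in (0 : ℝ)..1, 2 * s * ev (1 / 4) s (quad U χ) x) - c|
        ≤ C * ((∫ y in ann 1, v y) + ∫ y in ann 1, v y ^ 2) := by
  obtain ⟨θ, hθ, hθ0, hθ1, hθin, hθout⟩ := exists_cutoff (r := 3 / 100) (R := 1 / 20)
    (by norm_num) (by norm_num)
  obtain ⟨k, hk, hkev⟩ := exists_heat_kernel
  have hθ' : ∀ y, 1 / 20 < ‖y‖ → θ y = 0 := fun y hy => hθout y hy.le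
  have hj1 : JointSmooth fun _ y => θ y * gk (1 / 4) y :=
    (hθ.mul_smooth (smooth_gk _)).smooth.joint
  have z1 : ∀ s : ℝ, ∀ y, 1 / 20 < ‖y‖ → (fun _ y => θ y * gk (1 / 4) y) s y = 0 :=
    fun s y hy => by simp [hθ' y hy]
  have hj2 := jointSmooth_commKernel hk hθ
  have z2 := commKernel_eq_zero (k := k) hθ'
  have hj3 : JointSmooth fun s y => k s y * (1 - θ y) :=
    hk.mul (Smooth.joint (contDiff_const.sub hθ.smooth))
  obtain ⟨K1, hK1, hb1⟩ := hj1.bounded_pd_lapl z1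
  obtain ⟨K2, hK2, hb2⟩ := hj2.bounded_pd_lapl z2
  obtain ⟨K3, hK3, hb3⟩ := hj3.exists_quad_bound
  refine ⟨36 * K1 + 36 * K2 + K3, by positivity, fun U p v χ h hχ => ?_⟩
  set N1 := ∫ y in ann 1, v y with hN1
  set N2 := ∫ y in ann 1, v y ^ 2 with hN2
  have N1pos : 0 ≤ N1 := integral_nonneg fun y => h.nonneg_v y
  have N2pos : 0 ≤ N2 := integral_nonneg fun y => sq_nonneg _
  have near : ∀ y : E3, ‖y‖ < 1 / 50 → θ =ᶠ[nhds y] fun _ => 1 := fun y hy => by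
    filter_upwards [continuous_norm.continuousAt.eventually_mem (Iio_mem_nhds hy)] with w hw
    exact hθin w (by linarith [Set.mem_Iio.1 hw])
  have pdc : ∀ l (y : E3), pd l (fun _ : E3 => (1 : ℝ)) y = 0 := fun l y => by simp [pd]
  have hcomm : ∀ x y : E3, ‖y‖ < 1 / 50 → commutator p θ x y = 0 := fun x y hy => by
    have a1 : ∀ l, pd l θ y = 0 := fun l => (pd_eventuallyEq (near y hy)).eq_of_nhds.trans (pdc l y)
    have a2 : lapl θ y = 0 := Finset.sum_eq_zero fun l _ => by
      rw [(pd_eventuallyEq (pd_eventuallyEq (near y hy))).eq_of_nhds,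
        show pd l (fun _ : E3 => (1 : ℝ)) = fun _ => 0 from funext (pdc l)]
      simp [pd]
    simp [commutator, a1, a2]
  have hcorr : ∀ s, 0 < s → ∀ x, 2 * s * ev (1 / 4) s (commutator p θ x) 0
      = corr p (commKernel k θ s) x := fun s hs x => by
    rw [hkev _ (hcomm x) s hs, integral_mul_commutator hk h.smooth_p hθ]
  refine ⟨corr p (fun y => θ y * gk (1 / 4) y) basePt
    - ∫ s in (0 : ℝ)..1, 2 * s * ev (1 / 4) s (commutator p θ basePt) 0, fun x hx hx' => ?_⟩
  have b1 : |corr p (fun y => θ y * gk (1 / 4) y) x - corr p (fun y => θ y * gk (1 / 4) y) basePt|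
      ≤ 12 * (K1 * (N1 + 3 * N2)) :=
    h.abs_corr_sub_le (hθ.mul_smooth (smooth_gk _)) (z1 0) (hb1 0 (by simp)).1 (hb1 0 (by simp)).2
      hx hx'
  have b2 : |(∫ s in (0 : ℝ)..1, 2 * s * ev (1 / 4) s (commutator p θ x) 0)
      - ∫ s in (0 : ℝ)..1, 2 * s * ev (1 / 4) s (commutator p θ basePt) 0|
      ≤ 12 * (K2 * (N1 + 3 * N2)) := by
    rw [← intervalIntegral.integral_sub
      (((isTest_commutator h.smooth_p hθ x).continuous_mul_ev 0).intervalIntegrable _ _)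
      (((isTest_commutator h.smooth_p hθ basePt).continuous_mul_ev 0).intervalIntegrable _ _)]
    refine abs_intervalIntegral_le fun s hs hs' => ?_
    rw [hcorr s hs, hcorr s hs]
    exact h.abs_corr_sub_le (isTest_of_eq_zero (hj2.smooth s) (z2 s)) (z2 s)
      (hb2 s ⟨hs.le, hs'⟩).1 (hb2 s ⟨hs.le, hs'⟩).2 hx hx'
  have b3 : |∫ s in (0 : ℝ)..1, 2 * s * ev (1 / 4) s (fun y => (1 - θ y) * quad U χ (x + y)) 0|
      ≤ K3 * N2 := by
    refine abs_intervalIntegral_le fun s hs hs' => ?_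
    rw [hkev _ (fun y hy => by rw [hθin y (by linarith)]; ring) s hs]
    simp only [← mul_assoc]
    exact hb3 U p v χ h hχ s ⟨hs.le, hs'⟩ x (by linarith)
  have e := eq_corr_sub h.smooth_p hθ (hθin 0 (by rw [norm_zero]; norm_num)) x
  rw [h.integral_ev_cut hχ hθ hθout hx hx'] at e
  have t1 : 0 ≤ K1 * N1 := by positivity
  have t2 : 0 ≤ K2 * N1 := by positivity
  have t3 : 0 ≤ K3 * N1 := by positivity
  rw [e]
  rw [abs_le] at *
  constructor <;> linarith [b1.1, b1.2, b2.1, b2.2, b3.1, b3.2]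

end Caccioppoli

namespace Caccioppoli

variable {f g : E3 → ℝ} {i j : Fin 3} {U : Fin 3 → E3 → ℝ} {p v χ : E3 → ℝ}

/-- The pairing of `f` with the heat potential of `g`. -/
def pairing (f g : E3 → ℝ) : ℝ := ∫ s in (0 : ℝ)..1, 2 * s * ∫ x, f x * ev (1 / 4) s g x

theorem decays_pairing (hf : IsTest f) (hg : IsTest g) :
    Decays fun s x => 2 * s * (f x * ev (1 / 4) s g x) := by
  obtain ⟨C, hC0, hC⟩ := hf.le_wt
  have h1 : Decays fun _ x => f x := ⟨hf.continuous.comp continuous_snd, C, hC0, fun _ _ x => hC x⟩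
  have h2 := (h1.mul (hg.decays_ev quarter_pos').bdd).mul
    (Bdd.of_continuous (by fun_prop : Continuous fun s : ℝ => 2 * s))
  simpa only [mul_comm] using h2

theorem intervalIntegrable_pairing (hf : IsTest f) (hg : IsTest g) :
    IntervalIntegrable (fun s => 2 * s * ∫ x, f x * ev (1 / 4) s g x) volume 0 1 := by
  simpa only [integral_const_mul] using (decays_pairing hf hg).intervalIntegrable

theorem integral_mul_heat (hf : IsTest f) (hg : IsTest g) :
    ∫ x, f x * ∫ s in (0 : ℝ)..1, 2 * s * ev (1 / 4) s g x = pairing f g := by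
  have := (decays_pairing hf hg).integral_swap
  simp only [integral_const_mul] at this
  rw [pairing, ← this]
  refine integral_congr_ae (ae_of_all _ fun x => ?_)
  simp only
  rw [← intervalIntegral.integral_const_mul]
  congr 1
  funext s
  ring

theorem integrable_mul_heat (hf : IsTest f) (hg : IsTest g) :
    Integrable fun x => f x * ∫ s in (0 : ℝ)..1, 2 * s * ev (1 / 4) s g x := by
  have h := (decays_pairing hf hg).integrable_prod.integral_prod_right
  refine h.congr (ae_of_all _ fun x => ?_)
  simp only
  rw [← intervalIntegral.integral_of_le zero_le_one, ← intervalIntegral.integral_const_mul]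
  congr 1
  funext s
  ring

theorem integrable_mul_ev (hf : IsTest f) (hg : IsTest g) (s : ℝ) :
    Integrable fun x => f x * ev (1 / 4) s g x :=
  ((hg.continuous_ev quarter_pos').comp (by fun_prop : Continuous fun x : E3 => (s, x))
    |> hf.continuous.mul).integrable_of_hasCompactSupport hf.compact.mul_right

theorem pairing_add {h : E3 → ℝ} (hf : IsTest f) (hg : IsTest g) (hh : IsTest h) :
    pairing f (fun x => g x + h x) = pairing f g + pairing f h := by
  simp only [pairing, hg.ev_add hh, mul_add]
  rw [← intervalIntegral.integral_add (intervalIntegrable_pairing hf hg)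
    (intervalIntegrable_pairing hf hh)]
  congr 1
  funext s
  rw [integral_add (integrable_mul_ev hf hg s) (integrable_mul_ev hf hh s), mul_add]

theorem pairing_sum (hf : IsTest f) {F : Fin 3 → E3 → ℝ} (hF : ∀ l, IsTest (F l)) :
    pairing f (fun x => ∑ l, F l x) = ∑ l, pairing f (F l) := by
  simp only [Fin.sum_univ_three]
  rw [pairing_add hf ((hF 0).add (hF 1)) (hF 2), pairing_add hf (hF 0) (hF 1)]

theorem NS.cut_energy_le (h : NS U p v) (hχ : Cut χ) (hf : IsTest f)
    (hf0 : ∀ x : E3, ¬ (8 / 10 ≤ ‖x‖ ∧ ‖x‖ ≤ 9 / 10) → f x = 0) (hfv : ∀ x, |f x| ≤ v x)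
    {e : E3 → ℝ} (he : Smooth e) (h1 : ∀ x, v x ^ 2 ≤ e x) (h2 : ∀ x, e x ≤ 3 * v x ^ 2)
    (i j : Fin 3) :
    |pairing f (pd i (pd j fun x => χ x * e x))| ≤ 24 * ∫ x in ann 1, v x ^ 3 := by
  have hg : IsTest fun x => χ x * e x := hχ.test.mul_smooth he
  have hfg : ∀ x, f x ^ 2 ≤ χ x * e x := by
    intro x
    by_cases hx : 8 / 10 ≤ ‖x‖ ∧ ‖x‖ ≤ 9 / 10
    · rw [hχ.eq_one x (by linarith [hx.1]) (by linarith [hx.2]), one_mul]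
      exact (sq_le_sq' (abs_le.1 (hfv x)).1 (abs_le.1 (hfv x)).2).trans (h1 x)
    · rw [hf0 x hx]
      have := mul_nonneg (hχ.nonneg x) ((sq_nonneg _).trans (h1 x))
      simpa using this
  refine (abs_heat_pairing_le hf hg hfg j i).trans ?_
  have hle : ∀ x, (χ x * e x) * √(χ x * e x) ≤ (ann 1).indicator (fun x => 6 * v x ^ 3) x := by
    intro x
    by_cases hx : x ∈ ann 1
    · rw [Set.indicator_of_mem hx]
      have e0 : 0 ≤ e x := (sq_nonneg _).trans (h1 x)
      have a1 : χ x * e x ≤ 3 * v x ^ 2 := (mul_le_of_le_one_left e0 (hχ.le_one x)).trans (h2 x)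
      have a2 : √(χ x * e x) ≤ 2 * v x := by
        refine Real.sqrt_le_iff.2 ⟨by linarith [h.nonneg_v x], a1.trans ?_⟩
        nlinarith [sq_nonneg (v x)]
      calc _ ≤ 3 * v x ^ 2 * (2 * v x) :=
            mul_le_mul a1 a2 (Real.sqrt_nonneg _) (by positivity)
        _ = _ := by ring
    · rw [Set.indicator_of_notMem hx, hχ.eq_zero x hx]
      simp
  have hint : Integrable ((ann 1).indicator fun x => 6 * v x ^ 3) :=
    (integrable_indicator_iff (measurableSet_ann 1)).2
      (integrableOn_ann (continuous_const.mul (h.cont_v.pow 3)) 1)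
  have h3 : ∫ x, (χ x * e x) * √(χ x * e x) ≤ 6 * ∫ x in ann 1, v x ^ 3 := by
    rw [← integral_const_mul, ← integral_indicator (measurableSet_ann 1)]
    refine integral_mono_of_nonneg (ae_of_all _ fun x => ?_) hint (ae_of_all _ hle)
    exact mul_nonneg ((sq_nonneg _).trans (hfg x)) (Real.sqrt_nonneg _)
  linarith

theorem NS.abs_pairing_quad_le (h : NS U p v) (hχ : Cut χ) (hf : IsTest f)
    (hf0 : ∀ x : E3, ¬ (8 / 10 ≤ ‖x‖ ∧ ‖x‖ ≤ 9 / 10) → f x = 0) (hfv : ∀ x, |f x| ≤ v x) :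
    |pairing f (quad U χ)| ≤ 432 * ∫ x in ann 1, v x ^ 3 := by
  have hv2 : Smooth fun x => v x ^ 2 := by
    simp only [h.sq_v]
    exact ContDiff.sum fun i _ => (h.smooth i).pow 2
  have h2v : Smooth fun x => 2 * v x ^ 2 := contDiff_const.mul hv2
  have he : ∀ i j, Smooth fun x => 2 * v x ^ 2 + U i x * U j x := fun i j =>
    h2v.add (h.smooth_mul i j)
  have t1 : ∀ i j, IsTest fun x => χ x * (2 * v x ^ 2 + U i x * U j x) := fun i j =>
    hχ.test.mul_smooth (he i j)
  have t2 : IsTest fun x => χ x * (2 * v x ^ 2) := hχ.test.mul_smooth h2v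
  have ht := h.isTest_cut_mul hχ
  have key : ∀ i j, |pairing f (pd i (pd j fun x => χ x * (U i x * U j x)))|
      ≤ 48 * ∫ x in ann 1, v x ^ 3 := by
    intro i j
    have b1 := h.cut_energy_le hχ hf hf0 hfv (he i j)
      (fun x => by linarith [(abs_le.1 (h.abs_mul_le i j x)).1])
      (fun x => by linarith [(abs_le.1 (h.abs_mul_le i j x)).2]) i j
    have b2 := h.cut_energy_le hχ hf hf0 hfv h2v
      (fun x => by linarith [sq_nonneg (v x)]) (fun x => by linarith [sq_nonneg (v x)]) i j
    have e : pd i (pd j fun x => χ x * (2 * v x ^ 2 + U i x * U j x))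
        = fun x => pd i (pd j fun x => χ x * (2 * v x ^ 2)) x
          + pd i (pd j fun x => χ x * (U i x * U j x)) x := by
      have a1 : pd j (fun x => χ x * (2 * v x ^ 2 + U i x * U j x))
          = fun x => pd j (fun x => χ x * (2 * v x ^ 2)) x
            + pd j (fun x => χ x * (U i x * U j x)) x := by
        funext x
        rw [← pd_add t2.smooth (ht i j).smooth]
        simp only [mul_add]
      rw [a1]
      funext x
      exact pd_add (t2.pd j).smooth ((ht i j).pd j).smooth x
    rw [e, pairing_add hf ((t2.pd j).pd i) (((ht i j).pd j).pd i)] at b1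
    rw [abs_le] at b1 b2 ⊢
    constructor <;> linarith [b1.1, b1.2, b2.1, b2.2]
  have e : pairing f (quad U χ)
      = ∑ i, ∑ j, pairing f (pd i (pd j fun x => χ x * (U i x * U j x))) := by
    rw [show quad U χ = fun x => ∑ i, ∑ j, pd i (pd j fun y => χ y * (U i y * U j y)) x from rfl,
      pairing_sum hf fun i => IsTest.sum _ fun j _ => ((ht i j).pd j).pd i]
    exact Finset.sum_congr rfl fun i _ => pairing_sum hf fun j => ((ht i j).pd j).pd i
  rw [e]
  refine (Finset.abs_sum_le_sum_abs _ _).trans ((Finset.sum_le_sum fun i _ =>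
    (Finset.abs_sum_le_sum_abs _ _).trans (Finset.sum_le_sum fun j _ => key i j)).trans_eq ?_)
  simp
  ring

theorem exists_pressure_pairing_bound : ∃ C, 0 ≤ C ∧ ∀ (U : Fin 3 → E3 → ℝ) (p v f : E3 → ℝ),
    NS U p v → IsTest f → (∀ x : E3, ¬ (8 / 10 ≤ ‖x‖ ∧ ‖x‖ ≤ 9 / 10) → f x = 0) →
      (∀ x, |f x| ≤ v x) → ∫ x, f x = 0 →
      |∫ x, p x * f x| ≤ C * ((∫ x in ann 1, v x ^ 3)
        + ((∫ x in ann 1, v x) + ∫ x in ann 1, v x ^ 2) * ∫ x in ann 1, v x) := by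
  obtain ⟨C, hC0, hC⟩ := exists_pressure_bound
  obtain ⟨χ, hχ⟩ := exists_cut
  refine ⟨C + 432, by positivity, fun U p v f h hf hf0 hfv hfint => ?_⟩
  obtain ⟨c, hc⟩ := hC U p v χ h hχ
  set N1 := ∫ y in ann 1, v y with hN1
  set N2 := ∫ y in ann 1, v y ^ 2 with hN2
  set N3 := ∫ y in ann 1, v y ^ 3 with hN3
  have N1pos : 0 ≤ N1 := integral_nonneg fun y => h.nonneg_v y
  have N2pos : 0 ≤ N2 := integral_nonneg fun y => sq_nonneg _
  have N3pos : 0 ≤ N3 := integral_nonneg fun y => pow_nonneg (h.nonneg_v y) 3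
  have hq := h.isTest_quad hχ
  set T : E3 → ℝ := fun x => ∫ s in (0 : ℝ)..1, 2 * s * ev (1 / 4) s (quad U χ) x with hT
  have b1 := h.abs_pairing_quad_le hχ hf hf0 hfv
  rw [← integral_mul_heat hf hq] at b1
  have hmem : ∀ x : E3, 8 / 10 ≤ ‖x‖ ∧ ‖x‖ ≤ 9 / 10 → x ∈ ann 1 := fun x hx =>
    mem_ann.2 ⟨by linarith [hx.2], by linarith [hx.1]⟩
  have b2 : |∫ x, f x * ((p x - T x - c)
      * ({x : E3 | 8 / 10 ≤ ‖x‖ ∧ ‖x‖ ≤ 9 / 10}.indicator (fun _ => (1 : ℝ)) x))|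
      ≤ C * (N1 + N2) * ∫ x in ann 1, v x := by
    refine abs_integral_mul_le (measurableSet_ann 1) (integrableOn_ann h.cont_v 1)
      (fun x _ => ?_) (fun x hx => ?_) fun x _ => hfv x
    · by_cases hx : 8 / 10 ≤ ‖x‖ ∧ ‖x‖ ≤ 9 / 10
      · rw [Set.indicator_of_mem (by exact hx), mul_one]
        exact hc x hx.1 hx.2
      · rw [Set.indicator_of_notMem (by exact hx), mul_zero, abs_zero]
        positivity
    · rw [Set.indicator_of_notMem (by exact fun hx' => hx (hmem x hx')), mul_zero]
  have e : ∫ x, p x * f x = (∫ x, f x * T x) + ∫ x, f x * ((p x - T x - c)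
      * ({x : E3 | 8 / 10 ≤ ‖x‖ ∧ ‖x‖ ≤ 9 / 10}.indicator (fun _ => (1 : ℝ)) x)) := by
    have i1 : Integrable fun x => f x * T x := integrable_mul_heat hf hq
    have i2 : Integrable fun x => p x * f x := (h.smooth_p.mul_test hf).integrable
    have e1 : ∀ x, f x * ((p x - T x - c)
        * ({x : E3 | 8 / 10 ≤ ‖x‖ ∧ ‖x‖ ≤ 9 / 10}.indicator (fun _ => (1 : ℝ)) x))
        = p x * f x - f x * T x - c * f x := by
      intro x
      by_cases hx : 8 / 10 ≤ ‖x‖ ∧ ‖x‖ ≤ 9 / 10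
      · rw [Set.indicator_of_mem (by exact hx)]
        ring
      · rw [hf0 x hx]
        ring
    simp only [e1]
    rw [integral_sub (by exact i2.sub i1) (hf.integrable.const_mul c), integral_sub i2 i1,
      integral_const_mul, hfint]
    ring
  rw [e]
  refine (abs_add_le _ _).trans ((add_le_add b1 b2).trans ?_)
  have t1 : 0 ≤ C * N3 := by positivity
  have t2 : 0 ≤ (N1 + N2) * N1 := by positivity
  nlinarith

end Caccioppoli

namespace Caccioppoli

variable {f g : E3 → ℝ} {i j : Fin 3} {U : Fin 3 → E3 → ℝ} {p v φ : E3 → ℝ}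

/-- The squared Frobenius norm of the velocity gradient. -/
def gradSq (U : Fin 3 → E3 → ℝ) (x : E3) : ℝ := ∑ i, ∑ j, pd j (U i) x ^ 2

theorem gradSq_nonneg (U : Fin 3 → E3 → ℝ) (x : E3) : 0 ≤ gradSq U x :=
  Finset.sum_nonneg fun _ _ => Finset.sum_nonneg fun _ _ => sq_nonneg _

/-- The flux of the velocity through the level sets of a cutoff. -/
def flux (U : Fin 3 → E3 → ℝ) (φ : E3 → ℝ) (x : E3) : ℝ := ∑ i, U i x * pd i φ x

namespace NS

theorem smooth_sq (h : NS U p v) : Smooth fun x => v x ^ 2 := by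
  simp only [h.sq_v]
  exact ContDiff.sum fun i _ => (h.smooth i).pow 2

theorem isTest_flux (h : NS U p v) (hφ : IsTest φ) : IsTest (flux U φ) :=
  IsTest.sum _ fun i _ => (h.smooth i).mul_test (hφ.pd i)

theorem integral_transport (h : NS U p v) (hφ : IsTest φ) {q : E3 → ℝ} (hq : Smooth q) :
    ∫ x, φ x * ∑ i, U i x * pd i q x = - ∫ x, q x * flux U φ x := by
  have t : ∀ i, IsTest fun x => φ x * U i x := fun i => hφ.mul_smooth (h.smooth i)
  have i1 : ∀ i, Integrable fun x => φ x * U i x * pd i q x := fun i =>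
    ((t i).mul_smooth (hq.pd i)).integrable
  have i2 : ∀ i, Integrable fun x => pd i (fun x => φ x * U i x) x * q x := fun i =>
    (((t i).pd i).mul_smooth hq).integrable
  have e1 : ∀ x, φ x * ∑ i, U i x * pd i q x = ∑ i, φ x * U i x * pd i q x := fun x => by
    rw [Finset.mul_sum]
    exact Finset.sum_congr rfl fun i _ => by ring
  have e2 : ∀ x, q x * flux U φ x = ∑ i, pd i (fun x => φ x * U i x) x * q x := fun x => by
    simp_rw [pd_mul hφ.smooth (h.smooth _), add_mul]
    rw [Finset.sum_add_distrib, ← Finset.sum_mul, ← Finset.mul_sum, h.div, mul_zero, zero_mul,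
      zero_add, flux, Finset.mul_sum]
    exact Finset.sum_congr rfl fun i _ => by ring
  simp only [e1, e2]
  rw [integral_finsetSum _ fun i _ => i1 i, integral_finsetSum _ fun i _ => i2 i,
    ← Finset.sum_neg_distrib]
  exact Finset.sum_congr rfl fun i _ => integral_test_mul_pd (t i) hq i

theorem integral_flux (h : NS U p v) (hφ : IsTest φ) : ∫ x, flux U φ x = 0 := by
  have := h.integral_transport hφ (q := fun _ => 1) contDiff_const
  simpa [pd] using this.symm

theorem gradSq_eq (h : NS U p v) (x : E3) :
    gradSq U x = 1 / 2 * lapl (fun y => v y ^ 2) x - (∑ i, U i x * pd i p x)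
      - 1 / 2 * ∑ i, U i x * pd i (fun y => v y ^ 2) x := by
  have hs : (fun y => v y ^ 2) = fun y => ∑ i, U i y * U i y :=
    funext fun y => by rw [h.sq_v]; exact Finset.sum_congr rfl fun i _ => sq _
  have e1 : ∀ j y, pd j (fun y => v y ^ 2) y = ∑ i, 2 * (U i y * pd j (U i) y) := fun j y => by
    rw [hs, pd_sum _ fun i _ => h.smooth_mul i i]
    refine Finset.sum_congr rfl fun i _ => ?_
    rw [pd_mul (h.smooth i) (h.smooth i)]
    ring
  have e2 : lapl (fun y => v y ^ 2) x
      = ∑ i, (2 * (U i x * lapl (U i) x) + 2 * ∑ j, pd j (U i) x ^ 2) := by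
    have a : ∀ j, pd j (pd j fun y => v y ^ 2) x
        = ∑ i, 2 * (U i x * pd j (pd j (U i)) x + pd j (U i) x * pd j (U i) x) := fun j => by
      rw [show pd j (fun y => v y ^ 2) = fun y => ∑ i, 2 * (U i y * pd j (U i) y) from
        funext (e1 j), pd_sum _ fun i _ =>
          contDiff_const.mul ((h.smooth i).mul ((h.smooth i).pd j))]
      refine Finset.sum_congr rfl fun i _ => ?_
      rw [pd_const_mul _ ((h.smooth i).mul ((h.smooth i).pd j)),
        pd_mul (h.smooth i) ((h.smooth i).pd j)]
    rw [show lapl (fun y => v y ^ 2) x = ∑ j, pd j (pd j fun y => v y ^ 2) x from rfl]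
    simp_rw [a]
    rw [Finset.sum_comm]
    refine Finset.sum_congr rfl fun i _ => ?_
    simp only [lapl, Finset.mul_sum, ← Finset.sum_add_distrib]
    exact Finset.sum_congr rfl fun j _ => by ring
  rw [e2]
  simp only [e1, h.momentum, gradSq, Fin.sum_univ_three]
  ring

theorem integral_gradSq (h : NS U p v) (hφ : IsTest φ) :
    ∫ x, φ x * gradSq U x = 1 / 2 * (∫ x, v x ^ 2 * lapl φ x) + (∫ x, p x * flux U φ x)
      + 1 / 2 * ∫ x, v x ^ 2 * flux U φ x := by
  have hw := h.smooth_sq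
  have hT : ∀ {q}, Smooth q → Smooth fun x => ∑ i, U i x * pd i q x := fun hq =>
    ContDiff.sum fun i _ => (h.smooth i).mul (hq.pd i)
  have i1 := (hφ.mul_smooth hw.lapl).integrable
  have i2 := (hφ.mul_smooth (hT h.smooth_p)).integrable
  have i3 := (hφ.mul_smooth (hT hw)).integrable
  have e : ∀ x, φ x * gradSq U x = 1 / 2 * (φ x * lapl (fun y => v y ^ 2) x)
      - φ x * (∑ i, U i x * pd i p x)
      - 1 / 2 * (φ x * ∑ i, U i x * pd i (fun y => v y ^ 2) x) := fun x => by
    rw [h.gradSq_eq]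
    ring
  have el : ∫ x, φ x * lapl (fun y => v y ^ 2) x = ∫ x, v x ^ 2 * lapl φ x := by
    simp only [lapl, Finset.mul_sum]
    rw [integral_finsetSum _ fun i _ => (hφ.mul_smooth ((hw.pd i).pd i)).integrable,
      integral_finsetSum _ fun i _ => (hw.mul_test ((hφ.pd i).pd i)).integrable]
    refine Finset.sum_congr rfl fun i _ => ?_
    rw [integral_test_mul_pd hφ (hw.pd i), integral_smooth_mul_pd hw (hφ.pd i)]
    simp only [mul_comm]
  simp only [e]
  rw [integral_sub (by exact (i1.const_mul _).sub i2) (i3.const_mul _),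
    integral_sub (i1.const_mul _) i2, integral_const_mul, integral_const_mul, el,
    h.integral_transport hφ h.smooth_p, h.integral_transport hφ hw]
  ring

end NS

/-- Power mean inequalities on a set of finite measure. -/
theorem integral_power_means {A : Set E3} {w : E3 → ℝ} {M : ℝ}
    (hAf : volume A ≠ ⊤) (hM : volume.real A ≤ M) (hM0 : 0 < M) (hw0 : ∀ x, 0 ≤ w x)
    (h1 : IntegrableOn w A) (h2 : IntegrableOn (fun x => w x ^ 2) A)
    (h3 : IntegrableOn (fun x => w x ^ 3) A) :
    (∫ x in A, w x) * (∫ x in A, w x) ≤ M * ∫ x in A, w x ^ 2 ∧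
      (∫ x in A, w x ^ 2) * (∫ x in A, w x) ≤ M * ∫ x in A, w x ^ 3 := by
  set N1 := ∫ x in A, w x
  set N2 := ∫ x in A, w x ^ 2
  set N3 := ∫ x in A, w x ^ 3
  have N1pos : 0 ≤ N1 := integral_nonneg hw0
  obtain ⟨m, hm⟩ : ∃ m, m = N1 / M := ⟨_, rfl⟩
  have hm0 : 0 ≤ m := hm ▸ by positivity
  have hN1 : N1 = M * m := by rw [hm]; field_simp
  have ic : ∀ c : ℝ, IntegrableOn (fun _ : E3 => c) A := fun c => integrableOn_const hAf
  have icc : ∀ c : ℝ, ∫ _ in A, c = volume.real A * c := fun c => by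
    rw [setIntegral_const, smul_eq_mul]
  have a1 : 2 * m * N1 - volume.real A * m ^ 2 ≤ N2 := by
    rw [← icc, ← integral_const_mul, ← integral_sub (h1.const_mul _) (ic _)]
    refine integral_mono ((h1.const_mul _).sub (ic _)) h2 fun x => ?_
    nlinarith [sq_nonneg (w x - m)]
  have a2 : 3 * m ^ 2 * N1 - volume.real A * (2 * m ^ 3) ≤ N3 := by
    rw [← icc, ← integral_const_mul, ← integral_sub (h1.const_mul _) (ic _)]
    refine integral_mono ((h1.const_mul _).sub (ic _)) h3 fun x => ?_
    nlinarith [mul_nonneg (add_nonneg (hw0 x) (mul_nonneg zero_le_two hm0)) (sq_nonneg (w x - m))]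
  have a3 : 2 * m * N2 ≤ N3 + m ^ 2 * N1 := by
    rw [← integral_const_mul, ← integral_const_mul, ← integral_add h3 (h1.const_mul _)]
    refine integral_mono (h2.const_mul _) (h3.add (h1.const_mul _)) fun x => ?_
    have := mul_nonneg (hw0 x) (sq_nonneg (w x - m))
    nlinarith
  have b1 : volume.real A * m ^ 2 ≤ M * m ^ 2 := by gcongr
  have b2 : volume.real A * (2 * m ^ 3) ≤ M * (2 * m ^ 3) := by gcongr
  rw [hN1] at *
  constructor
  · have : M * m * m ≤ N2 := by nlinarith
    nlinarith
  · have : m * N2 ≤ N3 := by nlinarith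
    nlinarith

theorem exists_energy_bound : ∃ C, 0 ≤ C ∧ ∀ (U : Fin 3 → E3 → ℝ) (p v : E3 → ℝ), NS U p v →
    ∫ x in ball (0 : E3) (1 / 2), gradSq U x
      ≤ C * ((∫ x in ann 1, v x ^ 2) + ∫ x in ann 1, v x ^ 3) := by
  obtain ⟨C, hC0, hC⟩ := exists_pressure_pairing_bound
  obtain ⟨φ, hφ, hφ0, hφ1, hφin, hφout⟩ := exists_cutoff (r := 8 / 10) (R := 9 / 10)
    (by norm_num) (by norm_num)
  choose D hD0 hD using fun i => (hφ.pd i).bounded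
  obtain ⟨L, hL0, hL⟩ := hφ.lapl.bounded
  obtain ⟨S, hS⟩ : ∃ S, S = ∑ i, D i + 1 := ⟨_, rfl⟩
  have hS0 : 0 < S := by
    have := Finset.sum_nonneg fun i (_ : i ∈ Finset.univ) => hD0 i
    linarith
  have hfin : volume (ann 1) ≠ ⊤ := ((measure_mono Set.sdiff_subset).trans_lt measure_ball_lt_top).ne
  set M := volume.real (ann 1) + 1 with hM
  have hM0 : 0 < M := by positivity
  refine ⟨L + S * C * (1 + 2 * M) + S, by positivity, fun U p v h => ?_⟩
  set N1 := ∫ y in ann 1, v y with hN1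
  set N2 := ∫ y in ann 1, v y ^ 2 with hN2
  set N3 := ∫ y in ann 1, v y ^ 3 with hN3
  have N2pos : 0 ≤ N2 := integral_nonneg fun y => sq_nonneg _
  have N3pos : 0 ≤ N3 := integral_nonneg fun y => pow_nonneg (h.nonneg_v y) 3
  have near : ∀ y : E3, ‖y‖ < 8 / 10 → φ =ᶠ[nhds y] fun _ => 1 := fun y hy => by
    filter_upwards [continuous_norm.continuousAt.eventually_mem (Iio_mem_nhds hy)] with w hw
    exact hφin w (Set.mem_Iio.1 hw).le
  have hpd0 : ∀ l (x : E3), ¬ (8 / 10 ≤ ‖x‖ ∧ ‖x‖ ≤ 9 / 10) → pd l φ x = 0 := fun l x hx => by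
    rw [not_and_or, not_le, not_le] at hx
    rcases hx with hx | hx
    · rw [(pd_eventuallyEq (near x hx)).eq_of_nhds]
      simp [pd]
    · exact pd_eq_zero_of_lt_norm (fun y hy => hφout y hy.le) x hx
  have hlp0 : ∀ x : E3, ¬ (8 / 10 ≤ ‖x‖ ∧ ‖x‖ ≤ 9 / 10) → lapl φ x = 0 := fun x hx => by
    rw [not_and_or, not_le, not_le] at hx
    rcases hx with hx | hx
    · refine Finset.sum_eq_zero fun l _ => ?_
      rw [(pd_eventuallyEq (pd_eventuallyEq (near x hx))).eq_of_nhds,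
        show pd l (fun _ : E3 => (1 : ℝ)) = fun _ => 0 from funext fun y => by simp [pd]]
      simp [pd]
    · exact lapl_eq_zero_of_lt_norm (fun y hy => hφout y hy.le) x hx
  have hmem : ∀ x : E3, 8 / 10 ≤ ‖x‖ ∧ ‖x‖ ≤ 9 / 10 → x ∈ ann 1 := fun x hx =>
    mem_ann.2 ⟨by linarith [hx.2], by linarith [hx.1]⟩
  have b1 : |∫ x, v x ^ 2 * lapl φ x| ≤ L * N2 :=
    abs_integral_mul_le (measurableSet_ann 1) (integrableOn_ann (h.cont_v.pow 2) 1)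
      (fun x _ => hL x) (fun x hx => hlp0 x fun hx' => hx (hmem x hx'))
      fun x _ => (abs_of_nonneg (sq_nonneg _)).le
  have hfl : ∀ x, |flux U φ x| ≤ S * v x := fun x => by
    refine (Finset.abs_sum_le_sum_abs _ _).trans
      ((Finset.sum_le_sum (g := fun i => v x * D i) fun i _ => ?_).trans ?_)
    · rw [abs_mul]
      exact mul_le_mul (h.abs_comp_le i x) (hD i x) (abs_nonneg _) (h.nonneg_v x)
    · rw [← Finset.mul_sum, hS]
      nlinarith [h.nonneg_v x]
  have hfl0 : ∀ x : E3, ¬ (8 / 10 ≤ ‖x‖ ∧ ‖x‖ ≤ 9 / 10) → flux U φ x = 0 := fun x hx =>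
    Finset.sum_eq_zero fun i _ => by rw [hpd0 i x hx, mul_zero]
  have b2 : |∫ x, v x ^ 2 * flux U φ x| ≤ S * N3 := by
    have := abs_integral_mul_le (a := fun x => v x ^ 2 * flux U φ x)
      (b := (ann 1).indicator fun _ => (1 : ℝ)) (K := 1)
      (measurableSet_ann 1) (w := fun x => S * v x ^ 3)
      (integrableOn_ann (continuous_const.mul (h.cont_v.pow 3)) 1)
      (fun x hx => by simp [Set.indicator_of_mem hx]) (fun x hx => Set.indicator_of_notMem hx _)
      fun x _ => by
        rw [abs_mul, abs_of_nonneg (sq_nonneg (v x))]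
        nlinarith [hfl x, sq_nonneg (v x)]
    rw [integral_const_mul, one_mul] at this
    refine le_of_eq_of_le ?_ this
    congr 2
    funext x
    by_cases hx : x ∈ ann 1
    · simp [Set.indicator_of_mem hx]
    · rw [hfl0 x fun hx' => hx (hmem x hx')]
      simp
  have b3 := hC U p v (fun x => S⁻¹ * flux U φ x) h ((h.isTest_flux hφ).const_mul _)
    (fun x hx => by rw [hfl0 x hx, mul_zero])
    (fun x => by
      rw [abs_mul, abs_of_pos (inv_pos.2 hS0), inv_mul_le_iff₀ hS0]
      exact hfl x)
    (by rw [integral_const_mul, h.integral_flux hφ, mul_zero])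
  simp only [mul_left_comm (p _)] at b3
  rw [integral_const_mul, abs_mul, abs_of_pos (inv_pos.2 hS0), inv_mul_le_iff₀ hS0] at b3
  obtain ⟨m1, m2⟩ := integral_power_means hfin (M := M) (by linarith) hM0
    h.nonneg_v (integrableOn_ann h.cont_v 1) (integrableOn_ann (h.cont_v.pow 2) 1)
    (integrableOn_ann (h.cont_v.pow 3) 1)
  have hF : Smooth (gradSq U) := ContDiff.sum fun i _ => ContDiff.sum fun j _ =>
    ((h.smooth i).pd j).pow 2
  have b0 : ∫ x in ball (0 : E3) (1 / 2), gradSq U x ≤ ∫ x, φ x * gradSq U x := by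
    rw [← integral_indicator measurableSet_ball]
    refine integral_mono_of_nonneg (ae_of_all _ fun x => ?_) (hφ.mul_smooth hF).integrable
      (ae_of_all _ fun x => ?_)
    · exact Set.indicator_nonneg (fun x _ => gradSq_nonneg U x) x
    · refine Set.indicator_le' (fun x hx => ?_)
        (fun x _ => mul_nonneg (hφ0 x) (gradSq_nonneg U x)) x
      rw [hφin x (by rw [mem_ball_zero_iff] at hx; linarith), one_mul]
  rw [h.integral_gradSq hφ] at b0
  have b4 : S * (C * (N3 + (N1 + N2) * N1)) ≤ S * (C * (N3 + M * N2 + M * N3)) := by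
    refine mul_le_mul_of_nonneg_left (mul_le_mul_of_nonneg_left ?_ hC0) hS0.le
    have m1' : N1 * N1 ≤ M * N2 := m1
    have m2' : N2 * N1 ≤ M * N3 := m2
    linarith [add_mul N1 N2 N1]
  have b5 : ∫ x, p x * flux U φ x ≤ S * (C * (N3 + (N1 + N2) * N1)) := (abs_le.1 b3).2
  have t1 : 0 ≤ S * C * N2 := by positivity
  have t2 : 0 ≤ S * C * M * N2 := by positivity
  have t3 : 0 ≤ S * C * M * N3 := by positivity
  have t4 : 0 ≤ L * N3 := by positivity
  have t5 : 0 ≤ S * N2 := by positivity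
  have t6 : 0 ≤ L * N2 := by positivity
  have t7 : 0 ≤ S * N3 := by positivity
  nlinarith [(abs_le.1 b1).2, (abs_le.1 b2).2]

end Caccioppoli

namespace Caccioppoli

open scoped Pointwise

variable {U : Fin 3 → E3 → ℝ} {p v : E3 → ℝ}

theorem pd_const_smul_arg {f : E3 → ℝ} (hf : Smooth f) (i : Fin 3) (R : ℝ) :
    pd i (fun y => f (R • y)) = fun y => R * pd i f (R • y) := funext fun y => by
  simpa using pd_scale (i := i) hf 0 y R

theorem Smooth.comp_smul {f : E3 → ℝ} (hf : Smooth f) (R : ℝ) : Smooth fun y => f (R • y) :=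
  hf.comp (contDiff_const_smul R)

/-- The Navier–Stokes scaling. -/
theorem NS.scale (h : NS U p v) {R : ℝ} (hR : 0 ≤ R) :
    NS (fun i y => R * U i (R • y)) (fun y => R ^ 2 * p (R • y)) fun y => R * v (R • y) := by
  have e : ∀ i j, pd j (fun y => R * U i (R • y)) = fun y => R ^ 2 * pd j (U i) (R • y) :=
    fun i j => funext fun y => by
      rw [pd_const_mul _ ((h.smooth i).comp_smul R), pd_const_smul_arg (h.smooth i)]
      ring
  constructor
  · exact fun i => contDiff_const.mul ((h.smooth i).comp_smul R)
  · exact contDiff_const.mul (h.smooth_p.comp_smul R)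
  · intro i y
    rw [pd_const_mul _ (h.smooth_p.comp_smul R), pd_const_smul_arg h.smooth_p]
    simp only [lapl, e, h.momentum]
    simp_rw [pd_const_mul _ (((h.smooth i).pd _).comp_smul R), pd_const_smul_arg ((h.smooth i).pd _)]
    simp only [Fin.sum_univ_three]
    ring
  · intro y
    simp only [e]
    rw [← Finset.mul_sum, h.div, mul_zero]
  · exact continuous_const.mul (h.cont_v.comp (continuous_const_smul R))
  · exact fun y => mul_nonneg hR (h.nonneg_v _)
  · intro y
    simp only [mul_pow, h.sq_v, Finset.mul_sum]

theorem gradSq_scale (h : ∀ i, Smooth (U i)) (R : ℝ) (y : E3) :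
    gradSq (fun i y => R * U i (R • y)) y = R ^ 4 * gradSq U (R • y) := by
  simp only [gradSq]
  simp_rw [pd_const_mul _ ((h _).comp_smul R), pd_const_smul_arg (h _), Finset.mul_sum]
  exact Finset.sum_congr rfl fun i _ => Finset.sum_congr rfl fun j _ => by ring

theorem smul_ann_one {R : ℝ} (hR : 0 < R) : R • ann 1 = ann R := by
  rw [ann, Set.smul_set_sdiff₀ hR.ne', _root_.smul_ball hR.ne', _root_.smul_ball hR.ne', smul_zero,
    Real.norm_of_nonneg hR.le, mul_one, mul_one_div, ann]

theorem setIntegral_comp_smul_E3 (f : E3 → ℝ) (s : Set E3) {R : ℝ} (hR : 0 < R) :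
    ∫ y in s, f (R • y) = (R ^ 3)⁻¹ * ∫ x in R • s, f x := by
  rw [Measure.setIntegral_comp_smul _ _ _ hR.ne', finrank_euclideanSpace_fin, smul_eq_mul,
    abs_of_pos (by positivity)]

theorem exists_scaled_energy_bound : ∃ C, 0 ≤ C ∧ ∀ (U : Fin 3 → E3 → ℝ) (p v : E3 → ℝ),
    NS U p v → ∀ R > 0, ∫ x in ball (0 : E3) (R / 2), gradSq U x
      ≤ C * (R⁻¹ ^ 2 * (∫ x in ann R, v x ^ 2) + R⁻¹ * ∫ x in ann R, v x ^ 3) := by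
  obtain ⟨C, hC0, hC⟩ := exists_energy_bound
  refine ⟨C, hC0, fun U p v h R hR => ?_⟩
  have key := hC _ _ _ (h.scale hR.le)
  simp only [gradSq_scale h.smooth, mul_pow, integral_const_mul] at key
  rw [setIntegral_comp_smul_E3 _ _ hR, setIntegral_comp_smul_E3 (fun x => v x ^ 2) _ hR,
    setIntegral_comp_smul_E3 (fun x => v x ^ 3) _ hR, smul_ann_one hR, _root_.smul_ball hR.ne', smul_zero,
    Real.norm_of_nonneg hR.le, mul_one_div] at key
  have e := mul_le_mul_of_nonneg_left key (inv_nonneg.2 hR.le)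
  field_simp at e ⊢
  linarith

end Caccioppoli

namespace Caccioppoli

variable {u : E3 → E3} {p : E3 → ℝ}

theorem fderiv_apply_comp {w : E3 → E3} {x : E3} (hw : DifferentiableAt ℝ w x) (z : E3)
    (i : Fin 3) : fderiv ℝ w x z i = fderiv ℝ (fun y => w y i) x z := by
  have := ((EuclideanSpace.proj i : E3 →L[ℝ] ℝ).hasFDerivAt.comp x hw.hasFDerivAt).fderiv
  rw [show (fun y => w y i) = (EuclideanSpace.proj i : E3 →L[ℝ] ℝ) ∘ w from rfl, this]
  rfl

theorem smooth_comp (hu : ContDiff ℝ (⊤ : ℕ∞) u) (i : Fin 3) : Smooth fun x => u x i :=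
  (EuclideanSpace.proj i : E3 →L[ℝ] ℝ).contDiff.comp hu

theorem _root_.SteadyNS.ns (h : SteadyNS u p) (hu : ContDiff ℝ (⊤ : ℕ∞) u)
    (hp : ContDiff ℝ (⊤ : ℕ∞) p) : NS (fun i x => u x i) p fun x => ‖u x‖ := by
  have hd : Differentiable ℝ u := hu.differentiable (by simp)
  have hd' : ∀ j : Fin 3, Differentiable ℝ fun y => fderiv ℝ u y (bv j) := fun j =>
    ((hu.fderiv_right (m := ((⊤ : ℕ∞) : WithTop ℕ∞)) (by norm_cast)).clm_apply
      contDiff_const).differentiable (by simp)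
  constructor
  · exact smooth_comp hu
  · exact hp
  · intro i x
    have e := congrArg (fun w : E3 => w i) (h.1 x)
    have e1 : lap u x i = lapl (fun x => u x i) x := by
      simp only [lap, lapl, WithLp.ofLp_sum, Finset.sum_apply]
      refine Finset.sum_congr rfl fun j _ => ?_
      rw [fderiv_apply_comp (hd' j x)]
      simp_rw [fderiv_apply_comp (hd _)]
      rfl
    have e2 : conv u x i = ∑ j, u x j * pd j (fun x => u x i) x := by
      rw [conv, fderiv_apply_comp (hd x), fderiv_eq_sum_pd]
    have e3 : gradp p x i = pd i p x := by
      simp [gradp, pd, Pi.single_apply]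
    simp only [PiLp.add_apply, PiLp.neg_apply, PiLp.zero_apply, e1, e2, e3] at e
    linarith
  · intro x
    rw [← h.2 x]
    exact Finset.sum_congr rfl fun i _ => (fderiv_apply_comp (hd x) _ i).symm
  · exact hu.continuous.norm
  · exact fun x => norm_nonneg _
  · intro x
    simp [EuclideanSpace.norm_sq_eq]

theorem norm_fderiv_sq_le (hu : Differentiable ℝ u) (x : E3) :
    ‖fderiv ℝ u x‖ ^ 2 ≤ gradSq (fun i x => u x i) x := by
  have h0 := gradSq_nonneg (fun i x => u x i) x
  refine Real.le_sqrt (norm_nonneg _) h0 |>.1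
    (ContinuousLinearMap.opNorm_le_bound _ (Real.sqrt_nonneg _) fun z => ?_)
  refine le_of_sq_le_sq ?_ (by positivity)
  rw [mul_pow, Real.sq_sqrt h0, EuclideanSpace.norm_sq_eq, EuclideanSpace.norm_sq_eq, gradSq,
    Finset.sum_mul]
  refine Finset.sum_le_sum fun i _ => ?_
  rw [fderiv_apply_comp (hu x), fderiv_eq_sum_pd]
  simp only [Real.norm_eq_abs, sq_abs]
  rw [mul_comm]
  exact Finset.sum_mul_sq_le_sq_mul_sq _ _ _

end Caccioppoli

namespace Caccioppoli

theorem lintegral_rpow_Ioc {a s : ℝ} (ha : -1 < a) (hs : 0 < s) :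
    ∫⁻ t in Set.Ioc 0 s, ENNReal.ofReal (t ^ a) = ENNReal.ofReal (s ^ (a + 1) / (a + 1)) := by
  rw [← ofReal_integral_eq_lintegral_ofReal
    ((intervalIntegrable_iff_integrableOn_Ioc_of_le hs.le).1
      (intervalIntegral.intervalIntegrable_rpow' ha)),
    ← intervalIntegral.integral_of_le hs.le, integral_rpow (Or.inl ha),
    Real.zero_rpow (by linarith), sub_zero]
  exact (ae_restrict_iff' measurableSet_Ioc).2 (ae_of_all _ fun t ht => Real.rpow_nonneg ht.1.le _)

theorem lintegral_rpow_Ioi {a s : ℝ} (ha : a < -1) (hs : 0 < s) :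
    ∫⁻ t in Set.Ioi s, ENNReal.ofReal (t ^ a) = ENNReal.ofReal (-s ^ (a + 1) / (a + 1)) := by
  rw [← ofReal_integral_eq_lintegral_ofReal (integrableOn_Ioi_rpow_of_lt ha hs),
    integral_Ioi_rpow_of_lt ha hs]
  exact (ae_restrict_iff' measurableSet_Ioi).2
    (ae_of_all _ fun t ht => Real.rpow_nonneg (hs.trans ht).le _)

/-- A weak-type bound of exponent `q > 3` controls the third power on finite measure spaces. -/
theorem lintegral_cube_le {α : Type*} [MeasurableSpace α] (μ : Measure α) {f : α → ℝ}
    (hf0 : ∀ x, 0 ≤ f x) (hfm : AEMeasurable f μ) {q V N : ℝ} (hq : 3 < q) (hV : 0 < V)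
    (hμ : μ Set.univ ≤ ENNReal.ofReal V) (hN : 0 ≤ N)
    (hw : ∀ σ > 0, μ {x | σ < f x} ≤ ENNReal.ofReal ((N / σ) ^ q)) :
    ∫⁻ x, ENNReal.ofReal (f x ^ 3) ∂μ
      ≤ ENNReal.ofReal ((1 + 3 / (q - 3)) * (V ^ (1 - 3 / q) * N ^ 3)) := by
  have hlc := lintegral_rpow_eq_lintegral_meas_lt_mul μ (ae_of_all _ hf0) hfm (p := 3) (by norm_num)
  have e3 : ∀ x, f x ^ (3 : ℝ) = f x ^ 3 := fun x => by norm_cast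
  simp only [e3] at hlc
  rw [hlc]
  rcases hN.eq_or_lt with rfl | hN0
  · rw [setLIntegral_congr_fun (g := fun _ => 0) measurableSet_Ioi fun t ht => ?_]
    · simp
    · have := hw t ht
      rw [zero_div, Real.zero_rpow (by linarith), ENNReal.ofReal_zero, nonpos_iff_eq_zero] at this
      simp [this]
  obtain ⟨s, hs⟩ : ∃ s, s = N * V ^ (-(1 / q)) := ⟨_, rfl⟩
  have hs0 : 0 < s := hs ▸ by positivity
  have hq0 : (0 : ℝ) < q := by linarith
  have near : ∫⁻ t in Set.Ioc 0 s, μ {a | t < f a} * ENNReal.ofReal (t ^ ((3 : ℝ) - 1))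
      ≤ ENNReal.ofReal (V * (s ^ 3 / 3)) := by
    calc _ ≤ ∫⁻ t in Set.Ioc 0 s, ENNReal.ofReal V * ENNReal.ofReal (t ^ ((3 : ℝ) - 1)) :=
          lintegral_mono fun t => mul_le_mul_left ((measure_mono (Set.subset_univ _)).trans hμ) _
      _ = _ := by
          rw [lintegral_const_mul' _ _ ENNReal.ofReal_ne_top,
            lintegral_rpow_Ioc (by norm_num) hs0, ← ENNReal.ofReal_mul hV.le]
          norm_num
  have far : ∫⁻ t in Set.Ioi s, μ {a | t < f a} * ENNReal.ofReal (t ^ ((3 : ℝ) - 1))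
      ≤ ENNReal.ofReal (N ^ q * (s ^ (3 - q) / (q - 3))) := by
    calc _ ≤ ∫⁻ t in Set.Ioi s, ENNReal.ofReal (N ^ q) * ENNReal.ofReal (t ^ (2 - q)) := by
          refine setLIntegral_mono' measurableSet_Ioi fun t ht => ?_
          have ht0 : 0 < t := hs0.trans ht
          refine (mul_le_mul_left (hw t ht0) _).trans_eq ?_
          rw [← ENNReal.ofReal_mul (by positivity), ← ENNReal.ofReal_mul (by positivity),
            Real.div_rpow hN ht0.le, Real.rpow_sub ht0, Real.rpow_sub ht0]
          congr 1
          norm_num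
          field_simp
      _ = _ := by
          rw [lintegral_const_mul' _ _ ENNReal.ofReal_ne_top,
            lintegral_rpow_Ioi (by linarith) hs0, ← ENNReal.ofReal_mul (by positivity),
            show 2 - q + 1 = 3 - q by ring, ← neg_sub q 3, neg_div_neg_eq]
  have h3 : 0 < q - 3 := by linarith
  have es : s ^ 3 = N ^ 3 * V ^ (-(3 / q)) := by
    rw [hs, mul_pow, ← Real.rpow_mul_natCast hV.le]
    congr 2
    push_cast
    ring
  have e1 : V * s ^ 3 = V ^ (1 - 3 / q) * N ^ 3 := by
    rw [es, sub_eq_add_neg, Real.rpow_add hV, Real.rpow_one]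
    ring
  have e2 : N ^ q * s ^ (3 - q) = V ^ (1 - 3 / q) * N ^ 3 := by
    rw [hs, Real.mul_rpow hN (by positivity), ← Real.rpow_mul hV.le, Real.rpow_sub hN0]
    have : -(1 / q) * (3 - q) = 1 - 3 / q := by field_simp; ring
    rw [this]
    have : N ^ (3 : ℝ) = N ^ 3 := by norm_cast
    rw [this]
    have := (Real.rpow_pos_of_pos hN0 q).ne'
    field_simp
  rw [← Set.Ioc_union_Ioi_eq_Ioi hs0.le,
    lintegral_union measurableSet_Ioi (Set.Ioc_disjoint_Ioi le_rfl)]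
  refine (mul_le_mul_right (add_le_add near far) _).trans_eq ?_
  rw [← ENNReal.ofReal_add (by positivity) (by positivity), ← ENNReal.ofReal_mul (by norm_num)]
  congr 1
  rw [← mul_div_assoc, ← mul_div_assoc, e1, e2]
  ring

/-- The Lorentz quasinorm controls the weak quasinorm. -/
theorem exists_weak_le_lorentzNorm {α F : Type*} [MeasurableSpace α] [NormedAddCommGroup F]
    (μ : Measure α) {q : ℝ} (hq : 0 < q) {ℓ : ℝ≥0∞} (hℓ : 1 ≤ ℓ) :
    ∃ K : ℝ, 0 < K ∧ ∀ (f : α → F) (Ω : Set α), ∀ σ > 0,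
      ENNReal.ofReal σ * μ {x | x ∈ Ω ∧ σ < ‖f x‖} ^ (1 / q)
        ≤ ENNReal.ofReal K * lorentzNorm μ (ENNReal.ofReal q) ℓ f Ω := by
  by_cases hl : ℓ = ⊤
  · refine ⟨1, one_pos, fun f Ω σ hσ => ?_⟩
    rw [lorentzNorm, if_pos hl, ENNReal.ofReal_one, one_mul]
    refine le_iSup_of_le ⟨σ, hσ.le⟩ (le_of_eq ?_)
    rw [ENNReal.toReal_div, ENNReal.toReal_one, ENNReal.toReal_ofReal hq.le,
      ENNReal.ofReal_eq_coe_nnreal hσ.le]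
    rfl
  obtain ⟨l, hlr⟩ : ∃ l, l = ℓ.toReal := ⟨_, rfl⟩
  have hl1 : 1 ≤ l := by
    rw [hlr, ← ENNReal.toReal_one]
    exact ENNReal.toReal_mono hl hℓ
  have hl0 : 0 < l := by linarith
  refine ⟨l ^ (1 / l), by positivity, fun f Ω σ hσ => ?_⟩
  rw [lorentzNorm, if_neg hl, ENNReal.toReal_div, ENNReal.toReal_div, ENNReal.toReal_one,
    ENNReal.toReal_ofReal hq.le, ← hlr]
  set m := μ {x | x ∈ Ω ∧ σ < ‖f x‖}
  have key : ENNReal.ofReal (σ ^ l / l) * m ^ (l / q) ≤ ∫⁻ τ in Set.Ioi (0 : ℝ),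
      ENNReal.ofReal (τ ^ (l - 1)) * μ {x | x ∈ Ω ∧ τ < ‖f x‖} ^ (l / q) := by
    have e := lintegral_rpow_Ioc (a := l - 1) (by linarith) hσ
    rw [sub_add_cancel] at e
    rw [← e]
    refine (lintegral_mul_const_le _ _).trans ?_
    refine le_trans ?_ (lintegral_mono_set (Set.Ioc_subset_Ioi_self (a := σ) (b := 0)))
    refine setLIntegral_mono' measurableSet_Ioc fun t ht => ?_
    have hm : m ≤ μ {x | x ∈ Ω ∧ t < ‖f x‖} := measure_mono fun x hx => ⟨hx.1, ht.2.trans_lt hx.2⟩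
    gcongr
  have e2 := ENNReal.rpow_le_rpow key (show 0 ≤ 1 / l by positivity)
  refine le_trans (le_of_eq ?_) (mul_le_mul_right e2 _)
  rw [ENNReal.mul_rpow_of_nonneg _ _ (by positivity), ← ENNReal.rpow_mul,
    ENNReal.ofReal_rpow_of_nonneg (by positivity) (by positivity), ← mul_assoc,
    ← ENNReal.ofReal_mul (by positivity), Real.div_rpow (by positivity) hl0.le,
    ← Real.rpow_mul hσ.le, mul_one_div_cancel hl0.ne', Real.rpow_one]
  congr 2
  · field_simp
  · field_simp

theorem exists_cube_le_lorentzNorm {q : ℝ} (hq : 3 < q) {ℓ : ℝ≥0∞} (hℓ : 1 ≤ ℓ) :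
    ∃ K : ℝ, 0 < K ∧ ∀ u : E3 → E3, Continuous u → ∀ R > 0,
      ∫⁻ x in ann R, ENNReal.ofReal (‖u x‖ ^ 3) ≤ ENNReal.ofReal (K * R ^ (3 - 9 / q)) *
        lorentzNorm volume (ENNReal.ofReal q) ℓ u (ann R) ^ 3 := by
  have hq0 : (0 : ℝ) < q := by linarith
  have h3 : 0 < q - 3 := by linarith
  obtain ⟨K, hK, hw⟩ := exists_weak_le_lorentzNorm (F := E3) (volume : Measure E3) hq0 hℓ
  set c := volume.real (ball (0 : E3) 1)
  have hc : 0 < c := ENNReal.toReal_pos (measure_ball_pos _ _ one_pos).ne' measure_ball_lt_top.ne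
  refine ⟨(1 + 3 / (q - 3)) * c ^ (1 - 3 / q) * K ^ 3, by positivity, fun u hu R hR => ?_⟩
  set L := lorentzNorm volume (ENNReal.ofReal q) ℓ u (ann R)
  by_cases hL : L = ⊤
  · rw [hL, ENNReal.top_pow three_ne_zero, ENNReal.mul_top]
    · exact le_top
    · rw [Ne, ENNReal.ofReal_eq_zero, not_le]
      positivity
  have hvol : volume (ann R) ≤ ENNReal.ofReal (R ^ 3 * c) := by
    refine (measure_mono Set.sdiff_subset).trans_eq ?_
    rw [Measure.addHaar_ball _ _ hR.le, finrank_euclideanSpace_fin,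
      ENNReal.ofReal_mul (by positivity), ofReal_measureReal measure_ball_lt_top.ne]
  have key := lintegral_cube_le (volume.restrict (ann R)) (f := fun x => ‖u x‖)
    (fun x => norm_nonneg _) hu.norm.measurable.aemeasurable (V := R ^ 3 * c) (N := K * L.toReal) hq
    (by positivity) (by rwa [Measure.restrict_apply_univ]) (by positivity) fun σ hσ => ?_
  · refine key.trans_eq ?_
    have hR3 : (R ^ 3) ^ (1 - 3 / q) = R ^ (3 - 9 / q) := by
      rw [← Real.rpow_natCast_mul hR.le]
      congr 1
      push_cast
      ring
    rw [← ENNReal.ofReal_toReal (ENNReal.pow_ne_top hL : L ^ 3 ≠ ⊤), ← ENNReal.ofReal_mul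
      (by positivity), ENNReal.toReal_pow, Real.mul_rpow (by positivity) hc.le, hR3]
    congr 1
    ring
  · have h := hw u (ann R) σ hσ
    change _ ≤ _ * L at h
    rw [← ENNReal.ofReal_toReal hL, ← ENNReal.ofReal_mul hK.le] at h
    rw [Measure.restrict_apply (measurableSet_lt measurable_const hu.norm.measurable),
      show {x | σ < ‖u x‖} ∩ ann R = {x | x ∈ ann R ∧ σ < ‖u x‖} from
        Set.ext fun x => and_comm]
    set m := volume {x | x ∈ ann R ∧ σ < ‖u x‖}
    have h' : m ^ (1 / q) ≤ ENNReal.ofReal (K * L.toReal / σ) := by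
      rw [ENNReal.ofReal_div_of_pos hσ, ENNReal.le_div_iff_mul_le
        (Or.inl (ENNReal.ofReal_pos.2 hσ).ne') (Or.inl ENNReal.ofReal_ne_top), mul_comm]
      exact h
    have := ENNReal.rpow_le_rpow h' hq0.le
    rwa [← ENNReal.rpow_mul, one_div_mul_cancel hq0.ne', ENNReal.rpow_one,
      ENNReal.ofReal_rpow_of_nonneg (by positivity) hq0.le] at this

end Caccioppoli

open Caccioppoli

theorem stmt_8 (u : E3 → E3) (p : E3 → ℝ) (hu : ContDiff ℝ (⊤ : ℕ∞) u) (hp : ContDiff ℝ (⊤ : ℕ∞) p)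
    (hNS : SteadyNS u p) (q : ℝ) (hq : 3 < q) (ℓ : ℝ≥0∞) (hℓ : 1 ≤ ℓ) :
    ∃ C > 0, ∀ R > 0,
      (∫⁻ x in Metric.ball (0 : E3) (R / 2), ENNReal.ofReal (‖fderiv ℝ u x‖ ^ 2)) ≤
        ENNReal.ofReal (C * R ^ (-2 : ℝ)) * (∫⁻ x in ann R, ENNReal.ofReal (‖u x‖ ^ 2)) +
        ENNReal.ofReal (C * R ^ (2 - 9 / q)) *
          (lorentzNorm volume (ENNReal.ofReal q) ℓ u (ann R)) ^ 3 := by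
  obtain ⟨C, hC0, hC⟩ := exists_scaled_energy_bound
  obtain ⟨K, hK, hL⟩ := exists_cube_le_lorentzNorm hq hℓ
  have h := hNS.ns hu hp
  have hF : Smooth (gradSq fun i x => u x i) := ContDiff.sum fun i _ => ContDiff.sum fun j _ =>
    ((h.smooth i).pd j).pow 2
  refine ⟨C + C * K + 1, by positivity, fun R hR => ?_⟩
  have hR2 : R ^ (-2 : ℝ) = R⁻¹ ^ 2 := by
    rw [Real.rpow_neg hR.le, inv_pow]
    norm_cast
  have hRq : R ^ (2 - 9 / q) = R⁻¹ * R ^ (3 - 9 / q) := by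
    rw [← Real.rpow_neg_one, ← Real.rpow_add hR]
    congr 1
    ring
  have e2 : ENNReal.ofReal (∫ x in ann R, ‖u x‖ ^ 2) = ∫⁻ x in ann R, ENNReal.ofReal (‖u x‖ ^ 2) :=
    ofReal_integral_eq_lintegral_ofReal (integrableOn_ann (h.cont_v.pow 2) R)
      (ae_of_all _ fun x => by positivity)
  have e3 : ENNReal.ofReal (∫ x in ann R, ‖u x‖ ^ 3) = ∫⁻ x in ann R, ENNReal.ofReal (‖u x‖ ^ 3) :=
    ofReal_integral_eq_lintegral_ofReal (integrableOn_ann (h.cont_v.pow 3) R)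
      (ae_of_all _ fun x => by positivity)
  have n2 : 0 ≤ ∫ x in ann R, ‖u x‖ ^ 2 := integral_nonneg fun x => by positivity
  have n3 : 0 ≤ ∫ x in ann R, ‖u x‖ ^ 3 := integral_nonneg fun x => by positivity
  calc _ ≤ ∫⁻ x in ball (0 : E3) (R / 2), ENNReal.ofReal (gradSq (fun i x => u x i) x) :=
        lintegral_mono fun x => ENNReal.ofReal_le_ofReal
          (norm_fderiv_sq_le (hu.differentiable (by simp)) x)
    _ = ENNReal.ofReal (∫ x in ball (0 : E3) (R / 2), gradSq (fun i x => u x i) x) :=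
        (ofReal_integral_eq_lintegral_ofReal
          ((hF.continuous.continuousOn.integrableOn_compact (isCompact_closedBall _ _)).mono_set
            ball_subset_closedBall) (ae_of_all _ (gradSq_nonneg _))).symm
    _ ≤ ENNReal.ofReal (C * R⁻¹ ^ 2 * (∫ x in ann R, ‖u x‖ ^ 2)
          + C * R⁻¹ * ∫ x in ann R, ‖u x‖ ^ 3) :=
        ENNReal.ofReal_le_ofReal ((hC _ _ _ h R hR).trans_eq (by ring))
    _ = ENNReal.ofReal (C * R⁻¹ ^ 2) * (∫⁻ x in ann R, ENNReal.ofReal (‖u x‖ ^ 2))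
          + ENNReal.ofReal (C * R⁻¹) * ∫⁻ x in ann R, ENNReal.ofReal (‖u x‖ ^ 3) := by
        rw [ENNReal.ofReal_add (by positivity) (by positivity), ← e2, ← e3,
          ENNReal.ofReal_mul (p := C * R⁻¹ ^ 2) (by positivity),
          ENNReal.ofReal_mul (p := C * R⁻¹) (by positivity)]
    _ ≤ _ := by
        refine add_le_add ?_ ((mul_le_mul_right (hL u hu.continuous R hR) _).trans ?_)
        · rw [hR2]
          gcongr
          linarith [mul_nonneg hC0 hK.le]
        · rw [← mul_assoc, ← ENNReal.ofReal_mul (by positivity), hRq]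
          refine mul_le_mul_left (ENNReal.ofReal_le_ofReal ?_) _
          have : 0 ≤ R⁻¹ * R ^ (3 - 9 / q) := by positivity
          nlinarith
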